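/- arXiv:1610.00805 — 6 statements merged into one kernel-verified Lean document; each statement's English description precedes it below -/
import Mathlib

section
/- Let p ∈ ℝ[z_1,…,z_n] and q ∈ ℝ[w_1,…,w_m] be multi-affine same-phase stable polynomials (in disjoint sets of variables), and fix k ∈ {1,…,n}. Then the following polynomials are also multi-affine and same-phase stable: (i) the product p·q; (ii) the partial derivative ∂_{z_k} p; (iii) z_k · ∂_{z_k} p; (iv) the polynomial obtained from p by setting z_k = 0; (v) the selection inversion z_1 z_2 ⋯ z_n · p(z_1^{-1},…,z_n^{-1}). -/
open MvPolynomial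

/-- A univariate real polynomial is real-rooted: it is identically zero or
all of its complex roots are real. -/
def RealRooted (q : Polynomial ℝ) : Prop :=
  q = 0 ∨ ∀ z : ℂ, Polynomial.aeval z q = 0 → z.im = 0

/-- The univariate restriction `p(t₁ z, …, tₙ z)` of a multivariate polynomial. -/
noncomputable def diagRestrict {ι : Type*} (p : MvPolynomial ι ℝ) (t : ι → ℝ) : Polynomial ℝ :=
  MvPolynomial.aeval (fun i => Polynomial.C (t i) * Polynomial.X) p

/-- `p` is same-phase stable if every univariate restriction along a positive direction
is real-rooted. -/
def SamePhaseStable {ι : Type*} (p : MvPolynomial ι ℝ) : Prop :=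
  ∀ t : ι → ℝ, (∀ i, 0 < t i) → RealRooted (diagRestrict p t)

/-- A polynomial is multi-affine if it has degree at most one in each variable. -/
def MultiAffine {ι : Type*} (p : MvPolynomial ι ℝ) : Prop :=
  ∀ i : ι, p.degreeOf i ≤ 1

/-- Setting the variable `z_k` to `0`. -/
noncomputable def setVarZero {ι : Type*} [DecidableEq ι] (p : MvPolynomial ι ℝ) (k : ι) :
    MvPolynomial ι ℝ :=
  MvPolynomial.aeval (fun i => if i = k then 0 else MvPolynomial.X i) p

/-- The selection inversion `z₁ z₂ ⋯ zₙ ⋅ p(z₁⁻¹, …, zₙ⁻¹)` of a multi-affine polynomial: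
each monomial `∏_{i ∈ S} z_i` is replaced by `∏_{i ∉ S} z_i`. -/
noncomputable def selInv {ι : Type*} [Fintype ι] (p : MvPolynomial ι ℝ) : MvPolynomial ι ℝ :=
  ∑ s ∈ p.support,
    MvPolynomial.monomial (Finsupp.equivFunOnFinite.symm fun i => 1 - s i) (p.coeff s)

/-! ### Real-rooted univariate polynomials -/

/-- Moving from a nonreal point `z` to any point `w` enlarges a product of distances to real
points by at most a factor depending only on `z`, `w` and the number of points. -/
theorem norm_prod_sub_le_of_im_eq_zero {z : ℂ} (hz : z.im ≠ 0) (w : ℂ) (m : Multiset ℂ)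
    (hm : ∀ r ∈ m, r.im = 0) :
    ‖(m.map (fun r => w - r)).prod‖ ≤
      (‖w - z‖ / |z.im| + 1) ^ Multiset.card m * ‖(m.map (fun r => z - r)).prod‖ := by
  induction m using Multiset.induction_on with
  | empty => simp
  | cons r m ih =>
    have hpos : 0 < |z.im| := abs_pos.mpr hz
    have him : |z.im| ≤ ‖z - r‖ := by
      simpa [hm r (Multiset.mem_cons_self r m)] using Complex.abs_im_le_norm (z - r)
    have hr : ‖w - r‖ ≤ (‖w - z‖ / |z.im| + 1) * ‖z - r‖ := by
      calc ‖w - r‖ ≤ ‖w - z‖ + ‖z - r‖ := norm_sub_le_norm_sub_add_norm_sub w z r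
        _ = ‖w - z‖ / |z.im| * |z.im| + ‖z - r‖ := by rw [div_mul_cancel₀ _ hpos.ne']
        _ ≤ ‖w - z‖ / |z.im| * ‖z - r‖ + ‖z - r‖ := by gcongr
        _ = _ := by ring
    have ih := ih fun r hr => hm r (Multiset.mem_cons_of_mem hr)
    simp only [Multiset.map_cons, Multiset.prod_cons, norm_mul, Multiset.card_cons]
    calc _ ≤ _ := mul_le_mul hr ih (norm_nonneg _) (by positivity)
      _ = _ := by ring

theorem RealRooted.norm_aeval_le {h : Polynomial ℝ} (hh : RealRooted h) {N : ℕ}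
    (hN : h.natDegree ≤ N) {z : ℂ} (hz : z.im ≠ 0) (w : ℂ) :
    ‖Polynomial.aeval w h‖ ≤ (‖w - z‖ / |z.im| + 1) ^ N * ‖Polynomial.aeval z h‖ := by
  rcases hh with rfl | hh
  · simp
  set F := h.map (algebraMap ℝ ℂ) with hF
  have hs : F.Splits := IsAlgClosed.splits F
  have hroots : ∀ r ∈ F.roots, r.im = 0 := fun r hr => hh r <| by
    rw [← Polynomial.eval_map_algebraMap]
    exact (Polynomial.mem_roots'.mp hr).2
  have hcard : Multiset.card F.roots ≤ N :=
    (Polynomial.card_roots' F).trans (Polynomial.natDegree_map_le.trans hN)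
  rw [← Polynomial.eval_map_algebraMap, ← Polynomial.eval_map_algebraMap, ← hF,
    hs.eval_eq_prod_roots, hs.eval_eq_prod_roots, norm_mul, norm_mul, mul_left_comm]
  gcongr
  refine (norm_prod_sub_le_of_im_eq_zero hz w _ hroots).trans ?_
  gcongr
  exact le_add_of_nonneg_left (by positivity)

/-- A limit, along a pencil, of real-rooted polynomials is real-rooted. -/
theorem RealRooted.of_forall_add_C_mul {f g : Polynomial ℝ}
    (h : ∀ ε : ℝ, 0 < ε → RealRooted (f + Polynomial.C ε * g)) : RealRooted f := by
  refine or_iff_not_imp_right.mpr fun hf => ?_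
  push Not at hf
  obtain ⟨z, hz, him⟩ := hf
  set N := max f.natDegree g.natDegree
  have hN (ε : ℝ) : (f + Polynomial.C ε * g).natDegree ≤ N :=
    (Polynomial.natDegree_add_le _ _).trans
      (max_le_max le_rfl (Polynomial.natDegree_C_mul_le _ _))
  refine Polynomial.funext fun w => ?_
  have hcont (x : ℂ) : Filter.Tendsto
      (fun ε : ℝ => ‖Polynomial.aeval x (f + Polynomial.C ε * g)‖) (nhdsWithin 0 (Set.Ioi 0))
      (nhds ‖Polynomial.aeval x f‖) := by
    have hc : Continuous fun ε : ℝ => ‖Polynomial.aeval x (f + Polynomial.C ε * g)‖ := by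
      simp only [map_add, map_mul, Polynomial.aeval_C, Complex.coe_algebraMap]
      fun_prop
    simpa using (hc.tendsto 0).mono_left nhdsWithin_le_nhds
  have hle : ‖Polynomial.aeval (w : ℂ) f‖ ≤
      (‖(w : ℂ) - z‖ / |z.im| + 1) ^ N * ‖Polynomial.aeval z f‖ :=
    le_of_tendsto_of_tendsto (hcont w) ((hcont z).const_mul _) <| by
      filter_upwards [self_mem_nhdsWithin] with ε hε
      exact (h ε hε).norm_aeval_le (hN ε) him w
  rw [hz, norm_zero, mul_zero, norm_le_zero_iff] at hle
  have hw : Polynomial.aeval (algebraMap ℝ ℂ w) f = 0 := hle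
  rw [Polynomial.aeval_algebraMap_apply] at hw
  simpa using hw

theorem RealRooted.mul {f g : Polynomial ℝ} (hf : RealRooted f) (hg : RealRooted g) :
    RealRooted (f * g) := by
  rcases hf with rfl | hf
  · exact .inl (zero_mul g)
  rcases hg with rfl | hg
  · exact .inl (mul_zero f)
  refine .inr fun z hz => ?_
  rw [map_mul, mul_eq_zero] at hz
  exact hz.elim (hf z) (hg z)

theorem RealRooted.of_mul_left {f g : Polynomial ℝ} (hf : f ≠ 0) (h : RealRooted (f * g)) :
    RealRooted g := by
  refine h.imp (fun h => (mul_eq_zero.mp h).resolve_left hf) fun h z hz => h z ?_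
  rw [map_mul, hz, mul_zero]

theorem realRooted_C (c : ℝ) : RealRooted (Polynomial.C c) := by
  rcases eq_or_ne c 0 with rfl | hc
  · exact .inl Polynomial.C_0
  · exact .inr fun z hz => absurd hz (by simpa using hc)

theorem realRooted_X : RealRooted Polynomial.X :=
  .inr fun z hz => by simp_all

theorem RealRooted.reflect {f : Polynomial ℝ} (hf : RealRooted f) {N : ℕ}
    (hN : f.natDegree ≤ N) : RealRooted (f.reflect N) := by
  refine hf.imp (fun h => by rw [h, Polynomial.reflect_zero]) fun h z hz => ?_
  rcases eq_or_ne z 0 with rfl | hz0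
  · rfl
  let _ : Invertible z⁻¹ := invertibleOfNonzero (inv_ne_zero hz0)
  have him : (z⁻¹).im = 0 := h _ <|
    (Polynomial.eval₂_reflect_eq_zero_iff (algebraMap ℝ ℂ) z⁻¹ N f hN).mp <| by
      rwa [invOf_eq_inv, inv_inv]
  rw [← Complex.conj_eq_iff_im, map_inv₀, inv_inj] at him
  exact Complex.conj_eq_iff_im.mp him

/-! ### Multi-affine polynomials -/

theorem MultiAffine.apply_le_one {ι : Type*} {p : MvPolynomial ι ℝ} (hp : MultiAffine p)
    {s : ι →₀ ℕ} (hs : s ∈ p.support) (i : ι) : s i ≤ 1 :=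
  degreeOf_le_iff.mp (hp i) s hs

theorem multiAffine_monomial {ι : Type*} {s : ι →₀ ℕ} (hs : ∀ i, s i ≤ 1) (a : ℝ) :
    MultiAffine (monomial s a) := fun i => degreeOf_le_iff.mpr fun m hm => by
  rw [Finset.mem_singleton.mp (support_monomial_subset hm)]
  exact hs i

theorem multiAffine_zero {ι : Type*} : MultiAffine (0 : MvPolynomial ι ℝ) := fun i => by simp

theorem multiAffine_sum {ι α : Type*} {S : Finset α} {f : α → MvPolynomial ι ℝ}
    (hf : ∀ a ∈ S, MultiAffine (f a)) : MultiAffine (∑ a ∈ S, f a) := fun i =>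
  (degreeOf_sum_le i S f).trans (Finset.sup_le fun a ha => hf a ha i)

/-- A linear map preserving multi-affinity of monomials preserves multi-affinity. -/
theorem MultiAffine.map {ι : Type*} {p : MvPolynomial ι ℝ} (hp : MultiAffine p)
    (L : MvPolynomial ι ℝ →ₗ[ℝ] MvPolynomial ι ℝ)
    (hL : ∀ (s : ι →₀ ℕ) (a : ℝ), (∀ i, s i ≤ 1) → MultiAffine (L (monomial s a))) :
    MultiAffine (L p) := by
  rw [p.as_sum, map_sum]
  exact multiAffine_sum fun s hs => hL s _ (hp.apply_le_one hs)

theorem MultiAffine.rename_mul_rename {ι κ : Type*} {p : MvPolynomial ι ℝ}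
    {q : MvPolynomial κ ℝ} (hp : MultiAffine p) (hq : MultiAffine q) :
    MultiAffine (rename Sum.inl p * rename Sum.inr q : MvPolynomial (ι ⊕ κ) ℝ) := by
  intro i
  refine (degreeOf_mul_le _ _ _).trans ?_
  rcases i with i | i
  · have h : degreeOf (Sum.inl i) (rename Sum.inr q : MvPolynomial (ι ⊕ κ) ℝ) = 0 := by
      by_contra h
      obtain ⟨j, -, hj⟩ := mem_vars_rename _ _ (mem_vars_iff_degreeOf_ne_zero.mpr h)
      cases hj
    rw [h, degreeOf_rename_of_injective Sum.inl_injective, add_zero]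
    exact hp i
  · have h : degreeOf (Sum.inr i) (rename Sum.inl p : MvPolynomial (ι ⊕ κ) ℝ) = 0 := by
      by_contra h
      obtain ⟨j, -, hj⟩ := mem_vars_rename _ _ (mem_vars_iff_degreeOf_ne_zero.mpr h)
      cases hj
    rw [h, degreeOf_rename_of_injective Sum.inr_injective, zero_add]
    exact hq i

theorem MultiAffine.pderiv {ι : Type*} {p : MvPolynomial ι ℝ} (hp : MultiAffine p) (k : ι) :
    MultiAffine (pderiv k p) :=
  hp.map (MvPolynomial.pderiv k).toLinearMap fun s a hs => by
    rw [Derivation.coeFn_coe, pderiv_monomial]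
    exact multiAffine_monomial (fun i => (Nat.sub_le _ _).trans (hs i)) _

theorem MultiAffine.X_mul_pderiv {ι : Type*} {p : MvPolynomial ι ℝ} (hp : MultiAffine p)
    (k : ι) : MultiAffine (X k * MvPolynomial.pderiv k p) :=
  hp.map (LinearMap.mulLeft ℝ (X k) ∘ₗ (MvPolynomial.pderiv k).toLinearMap) fun s a hs => by
    rw [LinearMap.comp_apply, Derivation.coeFn_coe, LinearMap.mulLeft_apply,
      X_mul_pderiv_monomial, ← map_nsmul]
    exact multiAffine_monomial hs _

theorem setVarZero_monomial {ι : Type*} [DecidableEq ι] (k : ι) (s : ι →₀ ℕ) (a : ℝ) :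
    setVarZero (monomial s a) k = if s k = 0 then monomial s a else 0 := by
  rw [setVarZero, aeval_monomial]
  split_ifs with hk
  · rw [monomial_eq, algebraMap_eq]
    congr 1
    refine Finsupp.prod_congr fun i hi => ?_
    rw [if_neg]
    rintro rfl
    exact Finsupp.mem_support_iff.mp hi hk
  · rw [Finsupp.prod, Finset.prod_eq_zero (Finsupp.mem_support_iff.mpr hk), mul_zero]
    rw [if_pos rfl, zero_pow hk]

theorem MultiAffine.setVarZero {ι : Type*} [DecidableEq ι] {p : MvPolynomial ι ℝ}
    (hp : MultiAffine p) (k : ι) : MultiAffine (setVarZero p k) :=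
  hp.map (aeval fun i => if i = k then 0 else X i).toLinearMap fun s a hs => by
    change MultiAffine (_root_.setVarZero (monomial s a) k)
    rw [setVarZero_monomial]
    split_ifs
    · exact multiAffine_monomial hs a
    · exact multiAffine_zero

theorem multiAffine_selInv {ι : Type*} [Fintype ι] (p : MvPolynomial ι ℝ) :
    MultiAffine (selInv p) :=
  multiAffine_sum fun _ _ => multiAffine_monomial (fun _ => Nat.sub_le _ _) _

theorem MultiAffine.eq_setVarZero_add {ι : Type*} [DecidableEq ι] {p : MvPolynomial ι ℝ}
    (hp : MultiAffine p) (k : ι) :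
    p = _root_.setVarZero p k + X k * MvPolynomial.pderiv k p := by
  have hsum : _root_.setVarZero p k + X k * MvPolynomial.pderiv k p =
      ∑ s ∈ p.support, (_root_.setVarZero (monomial s (p.coeff s)) k +
        X k * MvPolynomial.pderiv k (monomial s (p.coeff s))) := by
    rw [Finset.sum_add_distrib, ← Finset.mul_sum, ← map_sum, ← p.as_sum]
    simp only [_root_.setVarZero]
    rw [← map_sum, ← p.as_sum]
  rw [hsum]
  conv_lhs => rw [p.as_sum]
  refine Finset.sum_congr rfl fun s hs => ?_
  rw [setVarZero_monomial, X_mul_pderiv_monomial]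
  have h := hp.apply_le_one hs k
  interval_cases s k <;> simp

/-! ### Restrictions to positive directions -/

theorem diagRestrict_congr {ι : Type*} {p : MvPolynomial ι ℝ} {t u : ι → ℝ}
    (h : ∀ i ∈ p.vars, t i = u i) : diagRestrict p t = diagRestrict p u :=
  eval₂Hom_congr' rfl (fun i hi _ => by rw [h i hi]) rfl

theorem notMem_vars_pderiv {ι : Type*} {p : MvPolynomial ι ℝ} (hp : MultiAffine p) (k : ι) :
    k ∉ (pderiv k p).vars := by
  rw [mem_vars_iff_degreeOf_ne_zero, not_not, ← Nat.le_zero, p.as_sum, map_sum]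
  refine (degreeOf_sum_le _ _ _).trans (Finset.sup_le fun s hs => ?_)
  rw [pderiv_monomial, degreeOf_le_iff]
  intro m hm
  rw [Finset.mem_singleton.mp (support_monomial_subset hm)]
  simpa using Nat.sub_eq_zero_of_le (hp.apply_le_one hs k)

theorem notMem_vars_setVarZero {ι : Type*} [DecidableEq ι] (p : MvPolynomial ι ℝ) (k : ι) :
    k ∉ (setVarZero p k).vars := by
  have hsum : setVarZero p k = ∑ s ∈ p.support, setVarZero (monomial s (p.coeff s)) k := by
    simp only [setVarZero]
    rw [← map_sum, ← p.as_sum]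
  rw [mem_vars_iff_degreeOf_ne_zero, not_not, ← Nat.le_zero, hsum]
  refine (degreeOf_sum_le _ _ _).trans (Finset.sup_le fun s _ => ?_)
  rw [setVarZero_monomial]
  split_ifs with hk
  · refine degreeOf_le_iff.mpr fun m hm => ?_
    rw [Finset.mem_singleton.mp (support_monomial_subset hm), hk]
  · simp

theorem diagRestrict_X_mul {ι : Type*} (p : MvPolynomial ι ℝ) (k : ι) (t : ι → ℝ) :
    diagRestrict (X k * p) t = Polynomial.C (t k) * (Polynomial.X * diagRestrict p t) := by
  rw [diagRestrict, map_mul, aeval_X, mul_assoc, diagRestrict]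

/-- Along the direction `t` with its `k`-th entry replaced by `c`, a multi-affine polynomial
restricts to a pencil with parameter `c`. -/
theorem MultiAffine.diagRestrict_update {ι : Type*} [DecidableEq ι] {p : MvPolynomial ι ℝ}
    (hp : MultiAffine p) (k : ι) (t : ι → ℝ) (c : ℝ) :
    diagRestrict p (Function.update t k c) = diagRestrict (_root_.setVarZero p k) t +
      Polynomial.C c * (Polynomial.X * diagRestrict (MvPolynomial.pderiv k p) t) := by
  have hu {f : MvPolynomial ι ℝ} (hf : k ∉ f.vars) :
      diagRestrict f (Function.update t k c) = diagRestrict f t :=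
    diagRestrict_congr fun i hi => Function.update_of_ne (ne_of_mem_of_not_mem hi hf) _ _
  conv_lhs => rw [hp.eq_setVarZero_add k, diagRestrict, map_add, ← diagRestrict, ← diagRestrict,
    diagRestrict_X_mul, hu (notMem_vars_pderiv hp k), hu (notMem_vars_setVarZero p k),
    Function.update_self]

theorem diagRestrict_monomial {ι : Type*} [Fintype ι] (s : ι →₀ ℕ) (a : ℝ) (t : ι → ℝ) :
    diagRestrict (monomial s a) t =
      Polynomial.C (a * ∏ i, t i ^ s i) * Polynomial.X ^ ∑ i, s i := by
  rw [diagRestrict, aeval_monomial, Finsupp.prod_fintype _ _ fun i => pow_zero _]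
  simp only [mul_pow, Finset.prod_mul_distrib, Finset.prod_pow_eq_pow_sum, map_mul, map_prod,
    map_pow, Polynomial.algebraMap_eq, mul_assoc]

theorem diagRestrict_sum {ι α : Type*} (S : Finset α) (f : α → MvPolynomial ι ℝ) (t : ι → ℝ) :
    diagRestrict (∑ a ∈ S, f a) t = ∑ a ∈ S, diagRestrict (f a) t :=
  map_sum _ _ _

theorem MultiAffine.natDegree_diagRestrict_le {ι : Type*} [Fintype ι] {p : MvPolynomial ι ℝ}
    (hp : MultiAffine p) (t : ι → ℝ) : (diagRestrict p t).natDegree ≤ Fintype.card ι := by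
  rw [p.as_sum, diagRestrict_sum]
  refine Polynomial.natDegree_sum_le_of_forall_le _ _ fun s hs => ?_
  rw [diagRestrict_monomial]
  refine (Polynomial.natDegree_C_mul_X_pow_le _ _).trans ?_
  simpa using Finset.sum_le_sum fun i (_ : i ∈ Finset.univ) => hp.apply_le_one hs i

theorem MultiAffine.diagRestrict_selInv {ι : Type*} [Fintype ι] {p : MvPolynomial ι ℝ}
    (hp : MultiAffine p) {t : ι → ℝ} (ht : ∀ i, 0 < t i) :
    diagRestrict (selInv p) t =
      Polynomial.C (∏ i, t i) * (diagRestrict p t⁻¹).reflect (Fintype.card ι) := by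
  have hreflect (S : Finset (ι →₀ ℕ)) (f : (ι →₀ ℕ) → Polynomial ℝ) (N : ℕ) :
      (∑ s ∈ S, f s).reflect N = ∑ s ∈ S, (f s).reflect N :=
    map_sum (⟨⟨Polynomial.reflect N, Polynomial.reflect_zero⟩,
      fun f g => Polynomial.reflect_add f g N⟩ : Polynomial ℝ →+ Polynomial ℝ) f S
  rw [selInv, diagRestrict_sum]
  conv_rhs => rw [p.as_sum, diagRestrict_sum, hreflect, Finset.mul_sum]
  refine Finset.sum_congr rfl fun s hs => ?_
  have hs := hp.apply_le_one hs
  have hcard : ∑ i, s i ≤ Fintype.card ι := by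
    simpa using Finset.sum_le_sum fun i (_ : i ∈ Finset.univ) => hs i
  have hexp : ∑ i, (1 - s i) = Fintype.card ι - ∑ i, s i := by
    rw [Finset.sum_tsub_distrib _ fun i _ => hs i]
    simp
  have hcoeff : ∏ i, t i ^ (1 - s i) = (∏ i, t i) * ∏ i, t⁻¹ i ^ s i := by
    rw [← Finset.prod_mul_distrib]
    refine Finset.prod_congr rfl fun i _ => ?_
    rw [pow_sub₀ _ (ht i).ne' (hs i), pow_one, Pi.inv_apply, inv_pow]
  rw [diagRestrict_monomial, diagRestrict_monomial, Polynomial.reflect_C_mul_X_pow,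
    Polynomial.revAt_le hcard, ← mul_assoc, ← Polynomial.C_mul]
  simp only [Finsupp.equivFunOnFinite_symm_apply_apply, hexp, hcoeff, mul_left_comm]

/-! ### Closure properties of same-phase stability -/

theorem SamePhaseStable.rename_mul_rename {ι κ : Type*} {p : MvPolynomial ι ℝ}
    {q : MvPolynomial κ ℝ} (hp : SamePhaseStable p) (hq : SamePhaseStable q) :
    SamePhaseStable (rename Sum.inl p * rename Sum.inr q : MvPolynomial (ι ⊕ κ) ℝ) := by
  intro t ht
  rw [diagRestrict, map_mul, aeval_rename, aeval_rename]
  exact (hp (t ∘ Sum.inl) fun i => ht _).mul (hq (t ∘ Sum.inr) fun i => ht _)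

theorem SamePhaseStable.setVarZero {ι : Type*} [DecidableEq ι] {p : MvPolynomial ι ℝ}
    (hp : SamePhaseStable p) (hA : MultiAffine p) (k : ι) :
    SamePhaseStable (setVarZero p k) := fun t ht =>
  RealRooted.of_forall_add_C_mul fun ε hε => by
    rw [← hA.diagRestrict_update]
    refine hp _ fun i => ?_
    rcases eq_or_ne i k with rfl | hi
    · simpa using hε
    · simpa [hi] using ht i

theorem SamePhaseStable.pderiv {ι : Type*} [DecidableEq ι] {p : MvPolynomial ι ℝ}
    (hp : SamePhaseStable p) (hA : MultiAffine p) (k : ι) :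
    SamePhaseStable (pderiv k p) := fun t ht =>
  RealRooted.of_mul_left Polynomial.X_ne_zero <|
    RealRooted.of_forall_add_C_mul (g := diagRestrict (_root_.setVarZero p k) t) fun ε hε => by
      have hscale : Polynomial.X * diagRestrict (MvPolynomial.pderiv k p) t +
          Polynomial.C ε * diagRestrict (_root_.setVarZero p k) t =
          Polynomial.C ε * diagRestrict p (Function.update t k ε⁻¹) := by
        rw [hA.diagRestrict_update, mul_add, ← mul_assoc (Polynomial.C ε) (Polynomial.C ε⁻¹),
          ← Polynomial.C_mul, mul_inv_cancel₀ hε.ne', Polynomial.C_1, one_mul, add_comm]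
      rw [hscale]
      refine (realRooted_C ε).mul (hp _ fun i => ?_)
      rcases eq_or_ne i k with rfl | hi
      · simpa using hε
      · simpa [hi] using ht i

theorem SamePhaseStable.X_mul {ι : Type*} {p : MvPolynomial ι ℝ} (hp : SamePhaseStable p)
    (k : ι) : SamePhaseStable (X k * p) := fun t ht => by
  rw [diagRestrict_X_mul]
  exact (realRooted_C _).mul (realRooted_X.mul (hp t ht))

theorem SamePhaseStable.selInv {ι : Type*} [Fintype ι] {p : MvPolynomial ι ℝ}
    (hp : SamePhaseStable p) (hA : MultiAffine p) : SamePhaseStable (selInv p) := fun t ht => by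
  rw [hA.diagRestrict_selInv ht]
  exact (realRooted_C _).mul <|
    (hp t⁻¹ fun i => inv_pos.mpr (ht i)).reflect (hA.natDegree_diagRestrict_le _)

/-- Closure properties of multi-affine same-phase stable polynomials:
disjoint product, differentiation, variable selection, variable deselection,
and selection inversion. -/
theorem samePhaseStable_closure {ι κ : Type*} [DecidableEq ι] [Fintype ι]
    (p : MvPolynomial ι ℝ) (q : MvPolynomial κ ℝ)
    (hpA : MultiAffine p) (hqA : MultiAffine q)
    (hp : SamePhaseStable p) (hq : SamePhaseStable q) (k : ι) :
    (MultiAffine (rename Sum.inl p * rename Sum.inr q) ∧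
      SamePhaseStable (rename Sum.inl p * rename Sum.inr q)) ∧
    (MultiAffine (pderiv k p) ∧ SamePhaseStable (pderiv k p)) ∧
    (MultiAffine (X k * pderiv k p) ∧ SamePhaseStable (X k * pderiv k p)) ∧
    (MultiAffine (setVarZero p k) ∧ SamePhaseStable (setVarZero p k)) ∧
    (MultiAffine (selInv p) ∧ SamePhaseStable (selInv p)) := by
  exact ⟨⟨hpA.rename_mul_rename hqA, hp.rename_mul_rename hq⟩,
    ⟨hpA.pderiv k, hp.pderiv hpA k⟩,
    ⟨hpA.X_mul_pderiv k, (hp.pderiv hpA k).X_mul k⟩,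
    ⟨hpA.setVarZero k, hp.setVarZero hpA k⟩,
    ⟨multiAffine_selInv p, hp.selInv hpA⟩⟩
end

section
/- For any finite simple graph G, the multivariate vertex matching polynomial μ_V(G) is real stable. -/
open MvPolynomial

/-- A real multivariate polynomial is real stable if it is identically zero or it has no zero
all of whose coordinates lie in the open upper half-plane. -/
def RealStable {ι : Type*} (p : MvPolynomial ι ℝ) : Prop :=
  p = 0 ∨ ∀ z : ι → ℂ, (∀ i, 0 < (z i).im) → MvPolynomial.aeval z p ≠ 0

/-- `M` is a matching of `G`, viewed as a finite set of edges: every member is an edge of `G`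
and distinct members share no vertex. -/
def IsMatchingFinset {V : Type*} (G : SimpleGraph V) (M : Finset (Sym2 V)) : Prop :=
  (∀ e ∈ M, e ∈ G.edgeSet) ∧ ∀ e ∈ M, ∀ f ∈ M, e ≠ f → ∀ x, x ∈ e → x ∉ f

open scoped Classical in
/-- The multivariate vertex matching polynomial
`μ_V(G) = Σ_{M matching} Π_{{u,v} ∈ M} (− x_u x_v)`. -/
noncomputable def vertexMatchingPoly {V : Type*} [Fintype V] [DecidableEq V]
    (G : SimpleGraph V) : MvPolynomial V ℝ :=
  ∑ M ∈ Finset.univ.filter (fun M : Finset (Sym2 V) => IsMatchingFinset G M),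
    ∏ e ∈ M, -(Sym2.lift ⟨fun a b => X a * X b, fun a b => mul_comm _ _⟩ e)

open scoped Classical in
/-- The matchings of `G` all of whose edges lie inside `S`. -/
noncomputable def matchingsWithin {V : Type*} [Fintype V] (G : SimpleGraph V) (S : Finset V) :
    Finset (Finset (Sym2 V)) :=
  Finset.univ.filter fun M => IsMatchingFinset G M ∧ ∀ e ∈ M, ∀ x ∈ e, x ∈ S

/-- The weighted matching sum of the subgraph of `G` induced on `S`. -/
noncomputable def matchingSum {V R : Type*} [Fintype V] [CommSemiring R] (G : SimpleGraph V)
    (w : Sym2 V → R) (S : Finset V) : R :=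
  ∑ M ∈ matchingsWithin G S, ∏ e ∈ M, w e

section MatchingSum

variable {V : Type*} [Fintype V] {G : SimpleGraph V} {S : Finset V} {M : Finset (Sym2 V)}

theorem mem_matchingsWithin :
    M ∈ matchingsWithin G S ↔ IsMatchingFinset G M ∧ ∀ e ∈ M, ∀ x ∈ e, x ∈ S := by
  simp [matchingsWithin]

theorem notMem_of_mem_matchingsWithin (hM : M ∈ matchingsWithin G S) {v : V} (hv : v ∉ S)
    (u : V) : s(v, u) ∉ M :=
  fun h => hv ((mem_matchingsWithin.1 hM).2 _ h v (Sym2.mem_mk_left v u))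

theorem matchingsWithin_empty : matchingsWithin G ∅ = {∅} := by
  ext M
  rw [mem_matchingsWithin, Finset.mem_singleton]
  constructor
  · rintro ⟨-, h⟩
    refine Finset.eq_empty_of_forall_notMem fun e he => ?_
    induction e with
    | _ a b => simpa using h _ he a (Sym2.mem_mk_left a b)
  · rintro rfl
    simp [IsMatchingFinset]

open scoped Classical in
theorem insert_mem_matchingsWithin {u v : V} (huS : u ∈ S) (hvS : v ∉ S) (huv : G.Adj v u)
    (hM : M ∈ matchingsWithin G (S.erase u)) :
    insert s(v, u) M ∈ matchingsWithin G (insert v S) := by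
  obtain ⟨⟨hE, hD⟩, hS⟩ := mem_matchingsWithin.1 hM
  have hv : ∀ e ∈ M, v ∉ e := fun e he h => hvS (Finset.mem_of_mem_erase (hS e he v h))
  have hu : ∀ e ∈ M, u ∉ e := fun e he h => Finset.notMem_erase u S (hS e he u h)
  refine mem_matchingsWithin.2 ⟨⟨?_, ?_⟩, ?_⟩
  · intro e he
    rcases Finset.mem_insert.1 he with rfl | he
    · exact huv
    · exact hE e he
  · intro e he f hf hef x hxe hxf
    rcases Finset.mem_insert.1 he with rfl | he' <;> rcases Finset.mem_insert.1 hf with rfl | hf'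
    · exact hef rfl
    · rcases Sym2.mem_iff.1 hxe with rfl | rfl
      · exact hv f hf' hxf
      · exact hu f hf' hxf
    · rcases Sym2.mem_iff.1 hxf with rfl | rfl
      · exact hv e he' hxe
      · exact hu e he' hxe
    · exact hD e he' f hf' hef x hxe hxf
  · intro e he x hx
    rcases Finset.mem_insert.1 he with rfl | he
    · rcases Sym2.mem_iff.1 hx with rfl | rfl
      · exact Finset.mem_insert_self _ _
      · exact Finset.mem_insert_of_mem huS
    · exact Finset.mem_insert_of_mem (Finset.mem_of_mem_erase (hS e he x hx))

open scoped Classical in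
theorem erase_mem_matchingsWithin {u v : V} (hM : M ∈ matchingsWithin G (insert v S))
    (hvu : s(v, u) ∈ M) : M.erase s(v, u) ∈ matchingsWithin G (S.erase u) := by
  obtain ⟨⟨hE, hD⟩, hS⟩ := mem_matchingsWithin.1 hM
  refine mem_matchingsWithin.2 ⟨⟨fun e he => hE e (Finset.mem_of_mem_erase he),
    fun e he f hf => hD e (Finset.mem_of_mem_erase he) f (Finset.mem_of_mem_erase hf)⟩, ?_⟩
  intro e he x hx
  obtain ⟨hne, he⟩ := Finset.mem_erase.1 he
  have hx' := hD e he _ hvu hne x hx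
  rw [Sym2.mem_iff, not_or] at hx'
  exact Finset.mem_erase.2 ⟨hx'.2, (Finset.mem_insert.1 (hS e he x hx)).resolve_left hx'.1⟩

open scoped Classical in
theorem matchingsWithin_insert {v : V} (hv : v ∉ S) :
    matchingsWithin G (insert v S) = matchingsWithin G S ∪
      (S.filter (G.Adj v)).biUnion fun u =>
        (matchingsWithin G (S.erase u)).image (insert s(v, u)) := by
  ext M
  simp only [Finset.mem_union, Finset.mem_biUnion, Finset.mem_filter, Finset.mem_image]
  constructor
  · intro hM
    obtain ⟨hMG, hS⟩ := mem_matchingsWithin.1 hM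
    by_cases h : ∃ u, s(v, u) ∈ M
    · obtain ⟨u, hu⟩ := h
      have hadj : G.Adj v u := hMG.1 _ hu
      have huS : u ∈ S :=
        (Finset.mem_insert.1 (hS _ hu u (Sym2.mem_mk_right v u))).resolve_left hadj.ne'
      exact Or.inr ⟨u, ⟨huS, hadj⟩, _, erase_mem_matchingsWithin hM hu, Finset.insert_erase hu⟩
    · refine Or.inl (mem_matchingsWithin.2 ⟨hMG, fun e he x hx => ?_⟩)
      refine (Finset.mem_insert.1 (hS e he x hx)).resolve_left ?_
      rintro rfl
      obtain ⟨u, rfl⟩ := hx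
      exact h ⟨u, he⟩
  · rintro (hM | ⟨u, ⟨huS, hadj⟩, N, hN, rfl⟩)
    · obtain ⟨hMG, hS⟩ := mem_matchingsWithin.1 hM
      exact mem_matchingsWithin.2 ⟨hMG, fun e he x hx => Finset.mem_insert_of_mem (hS e he x hx)⟩
    · exact insert_mem_matchingsWithin huS hv hadj hN

open scoped Classical in
/-- Expansion of the matching sum at a vertex `v`. -/
theorem matchingSum_insert {R : Type*} [CommSemiring R] (w : Sym2 V → R) {v : V} (hv : v ∉ S) :
    matchingSum G w (insert v S) = matchingSum G w S +
      ∑ u ∈ S.filter (G.Adj v), w s(v, u) * matchingSum G w (S.erase u) := by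
  have hve : ∀ u, v ∉ S.erase u := fun u h => hv (Finset.mem_of_mem_erase h)
  unfold matchingSum
  rw [matchingsWithin_insert hv, Finset.sum_union, Finset.sum_biUnion]
  · congr 1
    refine Finset.sum_congr rfl fun u _ => ?_
    rw [Finset.sum_image, Finset.mul_sum]
    · exact Finset.sum_congr rfl fun M hM =>
        Finset.prod_insert (notMem_of_mem_matchingsWithin hM (hve u) u)
    · intro M hM N hN h
      rw [← Finset.erase_insert (notMem_of_mem_matchingsWithin hM (hve u) u),
        ← Finset.erase_insert (notMem_of_mem_matchingsWithin hN (hve u) u)]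
      exact congrArg (fun K => K.erase s(v, u)) h
  · intro a _ b _ hab
    refine Finset.disjoint_left.2 fun K hKa hKb => ?_
    obtain ⟨M, hM, rfl⟩ := Finset.mem_image.1 hKa
    obtain ⟨N, hN, h⟩ := Finset.mem_image.1 hKb
    have hb : s(v, b) ∈ insert s(v, a) M := h ▸ Finset.mem_insert_self _ _
    rcases Finset.mem_insert.1 hb with hb | hb
    · exact hab (Sym2.congr_right.1 hb).symm
    · exact notMem_of_mem_matchingsWithin hM (hve a) b hb
  · refine Finset.disjoint_left.2 fun K hK hKb => ?_
    obtain ⟨u, -, hKu⟩ := Finset.mem_biUnion.1 hKb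
    obtain ⟨M, hM, rfl⟩ := Finset.mem_image.1 hKu
    exact notMem_of_mem_matchingsWithin hK hv u (Finset.mem_insert_self _ _)

theorem Complex.im_inv_neg {z : ℂ} (hz : 0 < z.im) : z⁻¹.im < 0 := by
  have h0 : z ≠ 0 := by
    rintro rfl
    simp at hz
  rw [Complex.inv_im]
  exact div_neg_of_neg_of_pos (neg_lt_zero.2 hz) (Complex.normSq_pos.2 h0)

theorem Complex.im_inv_pos {z : ℂ} (hz : z.im < 0) : 0 < z⁻¹.im := by
  have h0 : z ≠ 0 := by
    rintro rfl
    simp at hz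
  rw [Complex.inv_im]
  exact div_pos (neg_pos.2 hz) (Complex.normSq_pos.2 h0)

open scoped Classical in
/-- With vertex variables in the upper half-plane the matching sum does not vanish, and the
ratios between the sums for `S.erase v` and `S`, scaled by `z v`, lie in the upper half-plane. -/
theorem matchingSum_ne_zero_and_im_pos {z : V → ℂ} {w : Sym2 V → ℂ} (hz : ∀ v, 0 < (z v).im)
    (hw : ∀ a b, w s(a, b) = -(z a * z b)) (S : Finset V) :
    matchingSum G w S ≠ 0 ∧
      ∀ v ∈ S, 0 < (z v * matchingSum G w (S.erase v) / matchingSum G w S).im := by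
  induction S using Finset.strongInduction with
  | H S ih =>
    have key : ∀ v ∈ S, 0 < (z v * matchingSum G w (S.erase v) / matchingSum G w S).im := by
      intro v hv
      obtain ⟨hne, him⟩ := ih _ (Finset.erase_ssubset hv)
      have hzv : z v ≠ 0 := fun h => by simpa [h] using hz v
      have hratio : matchingSum G w S / (z v * matchingSum G w (S.erase v)) = (z v)⁻¹ -
          ∑ u ∈ (S.erase v).filter (G.Adj v),
            z u * matchingSum G w ((S.erase v).erase u) / matchingSum G w (S.erase v) := by
        have hexp := matchingSum_insert (G := G) w (Finset.notMem_erase v S)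
        rw [Finset.insert_erase hv] at hexp
        rw [hexp, add_div, sub_eq_add_neg, ← Finset.sum_neg_distrib, Finset.sum_div]
        congr 1
        · field_simp
        · refine Finset.sum_congr rfl fun u _ => ?_
          rw [hw]
          field_simp
      rw [← inv_div]
      apply Complex.im_inv_pos
      rw [hratio, Complex.sub_im, Complex.im_sum]
      have hsum := Finset.sum_nonneg fun u (hu : u ∈ (S.erase v).filter (G.Adj v)) =>
        (him u (Finset.mem_filter.1 hu).1).le
      linarith [Complex.im_inv_neg (hz v)]
    refine ⟨fun h0 => ?_, key⟩
    rcases S.eq_empty_or_nonempty with rfl | ⟨v, hv⟩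
    · simp [matchingSum, matchingsWithin_empty] at h0
    · simpa [h0] using key v hv

end MatchingSum

/-- For any finite simple graph `G`, the multivariate vertex matching polynomial `μ_V(G)` is
real stable. -/
theorem vertexMatchingPoly_realStable {V : Type*} [Fintype V] [DecidableEq V]
    (G : SimpleGraph V) : RealStable (vertexMatchingPoly G) := by
  refine Or.inr fun z hz => ?_
  let w : Sym2 V → ℂ := fun e =>
    aeval z (-(Sym2.lift ⟨fun a b => X a * X b, fun a b => mul_comm _ _⟩ e) : MvPolynomial V ℝ)
  have hw : ∀ a b, w s(a, b) = -(z a * z b) := fun a b => by simp [w]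
  have hsum : aeval z (vertexMatchingPoly G) = matchingSum G w Finset.univ := by
    simp only [vertexMatchingPoly, matchingSum, map_sum, map_prod, w]
    refine Finset.sum_congr ?_ fun _ _ => rfl
    ext M
    simp [mem_matchingsWithin]
  rw [hsum]
  exact (matchingSum_ne_zero_and_im_pos hz hw Finset.univ).1
end

section
/- For any claw-free finite simple graph G, the multivariate independence polynomial I(G) is same-phase stable. -/
open MvPolynomial
open scoped Classical

/-- A graph is claw-free if it has no induced subgraph isomorphic to the claw `K_{1,3}`. -/
def ClawFree {V : Type*} (G : SimpleGraph V) : Prop :=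
  IsEmpty (completeBipartiteGraph (Fin 1) (Fin 3) ↪g G)

/-- The multivariate independence polynomial
`I(G) = Σ_{S independent} Π_{v ∈ S} x_v` of a finite simple graph `G`. -/
noncomputable def indepPoly {α : Type*} [Fintype α] (H : SimpleGraph α) : MvPolynomial α ℝ :=
  ∑ S ∈ Finset.univ.filter (fun S : Finset α => ∀ a ∈ S, ∀ b ∈ S, ¬ H.Adj a b),
    ∏ a ∈ S, X a

section ClawFreeIndependence

variable {V : Type*}

/-- The independence polynomial of the subgraph of `G` induced on `S`, evaluated at `x`. -/
noncomputable def indepSum (G : SimpleGraph V) (x : V → ℂ) (S : Finset V) : ℂ :=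
  ∑ T ∈ S.powerset, if ∀ a ∈ T, ∀ b ∈ T, ¬ G.Adj a b then ∏ a ∈ T, x a else 0

/-- The vertices of `S` outside the closed neighbourhood of `v`. -/
noncomputable def deleteClosedNbhd (G : SimpleGraph V) (S : Finset V) (v : V) : Finset V :=
  S.filter fun w => w ≠ v ∧ ¬ G.Adj v w

/-- A clique `K` of the induced subgraph on `S` such that every vertex of `K` has a clique as
its neighbourhood in `S \ K`. -/
structure IsSimplicialClique_s6 (G : SimpleGraph V) (S K : Finset V) : Prop where
  subset : K ⊆ S
  adj : ∀ a ∈ K, ∀ b ∈ K, a ≠ b → G.Adj a b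
  nbhd_adj : ∀ a ∈ K, ∀ b ∈ S, ∀ c ∈ S, b ∉ K → c ∉ K → G.Adj a b → G.Adj a c → b ≠ c →
    G.Adj b c

theorem ClawFree.adj_of_adj {G : SimpleGraph V} (hG : ClawFree G) {c x y w : V}
    (hx : G.Adj c x) (hy : G.Adj c y) (hw : G.Adj c w) (hxy : x ≠ y) (hxw : x ≠ w)
    (hyw : y ≠ w) (nxy : ¬ G.Adj x y) (nxw : ¬ G.Adj x w) : G.Adj y w := by
  by_contra nyw
  have key : ∀ i j : Fin 3, ![x, y, w] i = ![x, y, w] j → i = j := by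
    intro i j; fin_cases i <;> fin_cases j <;> simp_all [eq_comm]
  have nadj : ∀ i j : Fin 3, ¬ G.Adj (![x, y, w] i) (![x, y, w] j) := by
    intro i j; fin_cases i <;> fin_cases j <;> simp_all [G.adj_comm]
  have cadj : ∀ i : Fin 3, G.Adj c (![x, y, w] i) := by
    intro i; fin_cases i <;> simp_all
  refine hG.false ⟨⟨Sum.elim (fun _ => c) ![x, y, w], ?_⟩, ?_⟩
  · rintro (i | i) (j | j) h
    · simp [Subsingleton.elim i j]
    · exact absurd h (cadj j).ne
    · exact absurd h.symm (cadj i).ne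
    · exact congrArg Sum.inr (key i j h)
  · rintro (i | i) (j | j)
    · exact iff_of_false G.irrefl (by simp)
    · exact iff_of_true (cadj j) (by simp)
    · exact iff_of_true (cadj i).symm (by simp)
    · exact iff_of_false (nadj i j) (by simp)

theorem deleteClosedNbhd_erase {G : SimpleGraph V} (S : Finset V) {u v : V} (huv : G.Adj u v) :
    deleteClosedNbhd G (S.erase v) u = deleteClosedNbhd G S u := by
  ext b
  simp only [deleteClosedNbhd, Finset.mem_filter, Finset.mem_erase]
  constructor
  · tauto
  · rintro ⟨h1, h2, h3⟩
    exact ⟨⟨fun h => h3 (h ▸ huv), h1⟩, h2, h3⟩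

theorem deleteClosedNbhd_subset_erase (G : SimpleGraph V) (S : Finset V) (v : V) :
    deleteClosedNbhd G S v ⊆ S.erase v := fun w hw => by
  simp only [deleteClosedNbhd, Finset.mem_filter] at hw
  exact Finset.mem_erase.2 ⟨hw.2.1, hw.1⟩

theorem indepSum_empty (G : SimpleGraph V) (x : V → ℂ) : indepSum G x ∅ = 1 := by
  simp [indepSum]

theorem indepSum_congr (G : SimpleGraph V) {x y : V → ℂ} {S : Finset V}
    (h : ∀ a ∈ S, x a = y a) : indepSum G x S = indepSum G y S := by
  refine Finset.sum_congr rfl fun T hT => ?_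
  rw [Finset.prod_congr rfl fun a ha => h a (Finset.mem_powerset.1 hT ha)]

/-- The vertex-deletion recurrence. -/
theorem indepSum_eq_erase_add (G : SimpleGraph V) (x : V → ℂ) {S : Finset V} {v : V}
    (hv : v ∈ S) :
    indepSum G x S =
      indepSum G x (S.erase v) + x v * indepSum G x (deleteClosedNbhd G S v) := by
  conv_lhs => rw [← Finset.insert_erase hv]
  unfold indepSum
  rw [Finset.sum_powerset_insert (Finset.notMem_erase v S), Finset.mul_sum]
  congr 1
  symm
  refine Finset.sum_subset_zero_on_sdiff ?_ ?_ ?_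
  · exact Finset.powerset_mono.2 (deleteClosedNbhd_subset_erase G S v)
  · intro T hT
    rw [Finset.mem_sdiff, Finset.mem_powerset, Finset.mem_powerset] at hT
    refine if_neg fun h => hT.2 fun w hw => ?_
    have hwS := Finset.mem_erase.1 (hT.1 hw)
    exact Finset.mem_filter.2 ⟨hwS.2, hwS.1,
      h v (Finset.mem_insert_self _ _) w (Finset.mem_insert_of_mem hw)⟩
  · intro T hT
    rw [Finset.mem_powerset] at hT
    have hT' : ∀ w ∈ T, w ≠ v ∧ ¬ G.Adj v w := fun w hw => (Finset.mem_filter.1 (hT hw)).2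
    have hvT : v ∉ T := fun h => (hT' v h).1 rfl
    have hiff : (∀ a ∈ insert v T, ∀ b ∈ insert v T, ¬ G.Adj a b) ↔
        ∀ a ∈ T, ∀ b ∈ T, ¬ G.Adj a b := by
      constructor
      · exact fun h a ha b hb => h a (Finset.mem_insert_of_mem ha) b (Finset.mem_insert_of_mem hb)
      · intro h a ha b hb
        rcases Finset.mem_insert.1 ha with rfl | haT <;>
          rcases Finset.mem_insert.1 hb with rfl | hbT
        · exact G.irrefl
        · exact (hT' b hbT).2
        · exact fun hab => (hT' a haT).2 hab.symm
        · exact h a haT b hbT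
    simp only [hiff, Finset.prod_insert hvT, mul_ite, mul_zero]

/-- The clique-deletion recurrence. -/
theorem indepSum_eq_sdiff_add_sum (G : SimpleGraph V) (x : V → ℂ) (K : Finset V) :
    ∀ S : Finset V, K ⊆ S → (∀ a ∈ K, ∀ b ∈ K, a ≠ b → G.Adj a b) →
      indepSum G x S =
        indepSum G x (S \ K) + ∑ w ∈ K, x w * indepSum G x (deleteClosedNbhd G S w) := by
  induction K using Finset.induction_on with
  | empty => simp
  | insert w K hw ih =>
    intro S hKS hK
    rw [indepSum_eq_erase_add G x (hKS (Finset.mem_insert_self w K)),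
      ih (S.erase w), Finset.sum_insert hw]
    · have h1 : S.erase w \ K = S \ insert w K := by grind
      have h2 : ∀ a ∈ K, deleteClosedNbhd G (S.erase w) a = deleteClosedNbhd G S a := by
        exact fun a ha => deleteClosedNbhd_erase S <| hK a (Finset.mem_insert_of_mem ha) w
          (Finset.mem_insert_self w K) fun h => hw (h ▸ ha)
      rw [h1, Finset.sum_congr rfl fun a ha => by rw [h2 a ha]]
      ring
    · exact fun a ha => Finset.mem_erase.2 ⟨fun h => hw (h ▸ ha),
        hKS (Finset.mem_insert_of_mem ha)⟩
    · exact fun a ha b hb => hK a (Finset.mem_insert_of_mem ha) b (Finset.mem_insert_of_mem hb)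

/-- Deleting a simplicial clique from a claw-free graph leaves, for each vertex of the clique,
its remaining neighbourhood as a simplicial clique. -/
theorem IsSimplicialClique_s6.nbhd {G : SimpleGraph V} (hG : ClawFree G) {S K : Finset V}
    (hK : IsSimplicialClique_s6 G S K) {w : V} (hw : w ∈ K) :
    IsSimplicialClique_s6 G (S \ K) ((S \ K).filter (G.Adj w)) where
  subset := Finset.filter_subset _ _
  adj a ha b hb hab := by
    simp only [Finset.mem_filter, Finset.mem_sdiff] at ha hb
    exact hK.nbhd_adj w hw a ha.1.1 b hb.1.1 ha.1.2 hb.1.2 ha.2 hb.2 hab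
  nbhd_adj a ha b hb c hc hbK hcK hab hac hbc := by
    simp only [Finset.mem_filter, Finset.mem_sdiff, not_and] at ha hb hc hbK hcK
    exact hG.adj_of_adj ha.2.symm hab hac (fun h => hb.2 (h ▸ hw)) (fun h => hc.2 (h ▸ hw)) hbc
      (hbK hb) (hcK hc)

/-- For adjacent `u`, `v` in a claw-free graph, the neighbours of `u` form a simplicial clique
after the closed neighbourhood of `v` is deleted. -/
theorem ClawFree.isSimplicialClique {G : SimpleGraph V} (hG : ClawFree G) (S : Finset V)
    {u v : V} (huv : G.Adj u v) :
    IsSimplicialClique_s6 G (deleteClosedNbhd G S v)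
      ((deleteClosedNbhd G S v).filter (G.Adj u)) where
  subset := Finset.filter_subset _ _
  adj a ha b hb hab := by
    simp only [Finset.mem_filter, deleteClosedNbhd] at ha hb
    exact hG.adj_of_adj huv ha.2 hb.2 ha.1.2.1.symm hb.1.2.1.symm hab ha.1.2.2 hb.1.2.2
  nbhd_adj a ha b hb c hc hbK hcK hab hac hbc := by
    simp only [Finset.mem_filter, deleteClosedNbhd, not_and] at ha hb hc hbK hcK
    exact hG.adj_of_adj ha.2.symm hab hac (fun h => hb.2.2 (h ▸ huv.symm))
      (fun h => hc.2.2 (h ▸ huv.symm)) hbc (hbK hb) (hcK hc)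

/-- Deleting a simplicial clique divides the independence polynomial by a number whose argument
lies in `[0, arg z)`. -/
theorem IsSimplicialClique_s6.ratio_im {G : SimpleGraph V} (hG : ClawFree G) {t : V → ℝ}
    (ht : ∀ i, 0 < t i) {z : ℂ} (hz : 0 < z.im) (S : Finset V) :
    ∀ K : Finset V, (∀ T ⊆ S, indepSum G (fun i => t i * z) T ≠ 0) → IsSimplicialClique_s6 G S K →
      0 ≤ (indepSum G (fun i => t i * z) S / indepSum G (fun i => t i * z) (S \ K)).im ∧
      (indepSum G (fun i => t i * z) S / indepSum G (fun i => t i * z) (S \ K) / z).im < 0 := by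
  induction S using Finset.strongInduction with
  | H S ih =>
    intro K hne hK
    set F := indepSum G (fun i => t i * z) with hF
    have hz0 : z ≠ 0 := by rintro rfl; simp at hz
    have hd : F (S \ K) ≠ 0 := hne _ Finset.sdiff_subset
    have hrec : F S / F (S \ K) =
        1 + ∑ w ∈ K, (t w : ℂ) * (z * (F (deleteClosedNbhd G S w) / F (S \ K))) := by
      rw [hF, indepSum_eq_sdiff_add_sum G _ K S hK.subset hK.adj, ← hF, add_div, div_self hd,
        Finset.sum_div]
      congr 1
      exact Finset.sum_congr rfl fun w _ => by ring
    have hw : ∀ w ∈ K, 0 ≤ (z * (F (deleteClosedNbhd G S w) / F (S \ K))).im ∧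
        (F (deleteClosedNbhd G S w) / F (S \ K)).im ≤ 0 := by
      intro w hwK
      have hset : deleteClosedNbhd G S w = (S \ K) \ (S \ K).filter (G.Adj w) := by
        ext b
        simp only [deleteClosedNbhd, Finset.mem_filter, Finset.mem_sdiff]
        constructor
        · rintro ⟨h1, h2, h3⟩
          have hb : b ∉ K := fun hb => h3 (hK.adj w hwK b hb h2.symm)
          tauto
        · rintro ⟨⟨h1, h2⟩, h3⟩
          exact ⟨h1, fun h => h2 (h ▸ hwK), fun h => h3 ⟨⟨h1, h2⟩, h⟩⟩
      obtain ⟨h1, h2⟩ := ih (S \ K)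
        (Finset.sdiff_ssubset hK.subset ⟨w, hwK⟩) _
        (fun T hT => hne T (hT.trans Finset.sdiff_subset)) (hK.nbhd hG hwK)
      rw [hset]
      set R := F (S \ K) / F ((S \ K) \ (S \ K).filter (G.Adj w)) with hR
      have hinv : F ((S \ K) \ (S \ K).filter (G.Adj w)) / F (S \ K) = R⁻¹ := by
        rw [hR, inv_div]
      rw [hinv]
      constructor
      · have : z * R⁻¹ = (R / z)⁻¹ := by
          rw [div_eq_mul_inv R z, mul_inv, inv_inv, mul_comm]
        rw [this, Complex.inv_im]
        exact div_nonneg (by linarith) (Complex.normSq_nonneg _)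
      · rw [Complex.inv_im]
        exact div_nonpos_of_nonpos_of_nonneg (by linarith) (Complex.normSq_nonneg _)
    rw [hrec]
    constructor
    · rw [Complex.add_im, Complex.one_im, zero_add, Complex.im_sum]
      refine Finset.sum_nonneg fun w hwK => ?_
      rw [Complex.im_ofReal_mul]
      exact mul_nonneg (ht w).le (hw w hwK).1
    · have : (1 + ∑ w ∈ K, (t w : ℂ) * (z * (F (deleteClosedNbhd G S w) / F (S \ K)))) / z =
          z⁻¹ + ∑ w ∈ K, (t w : ℂ) * (F (deleteClosedNbhd G S w) / F (S \ K)) := by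
        rw [add_div, Finset.sum_div, one_div]
        congr 1
        exact Finset.sum_congr rfl fun w _ => by field_simp
      rw [this, Complex.add_im, Complex.im_sum]
      refine add_neg_of_neg_of_nonpos ?_ (Finset.sum_nonpos fun w hwK => ?_)
      · rw [Complex.inv_im]
        exact div_neg_of_neg_of_pos (by linarith) (Complex.normSq_pos.2 hz0)
      · rw [Complex.im_ofReal_mul]
        exact mul_nonpos_of_nonneg_of_nonpos (ht w).le (hw w hwK).2

theorem add_add_ne_zero_of_arg_add_arg_eq {B C : ℂ} (hB : B ∈ Complex.slitPlane)
    (hC : C ∈ Complex.slitPlane) (h : B.arg + (C / B).arg = C.arg) : 1 + B + C ≠ 0 := by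
  intro h0
  have hB0 : B ≠ 0 := Complex.slitPlane_ne_zero hB
  have hC' : C = -1 - B := by linear_combination h0
  have hCim : C.im = -B.im := by simp [hC']
  have hdiv : (C / B).im = B.im / Complex.normSq B := by
    have : C / B = -1 - B⁻¹ := by rw [hC']; field_simp; ring
    simp [this, neg_div]
  have hN : 0 < Complex.normSq B := Complex.normSq_pos.2 hB0
  rcases lt_trichotomy B.im 0 with hlt | heq | hgt
  · have h1 : B.arg < 0 := Complex.arg_neg_iff.2 hlt
    have h2 : 0 ≤ C.arg := Complex.arg_nonneg_iff.2 (by linarith)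
    have h3 : 0 ≤ (C / B).im := Complex.arg_nonneg_iff.1 (by linarith)
    rw [hdiv] at h3
    exact absurd (div_neg_of_neg_of_pos hlt hN) (not_lt.2 h3)
  · have h1 : 0 < B.re := by simpa [Complex.mem_slitPlane_iff, heq] using hB
    have h2 : 0 < C.re := by simpa [Complex.mem_slitPlane_iff, hCim, heq] using hC
    have h3 := congrArg Complex.re h0
    simp only [Complex.add_re, Complex.one_re, Complex.zero_re] at h3
    linarith
  · have h1 : 0 ≤ B.arg := Complex.arg_nonneg_iff.2 hgt.le
    have h2 : C.arg < 0 := Complex.arg_neg_iff.2 (by linarith)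
    have h3 : (C / B).im < 0 := Complex.arg_neg_iff.1 (by linarith)
    rw [hdiv] at h3
    exact absurd (div_pos hgt hN) (not_lt.2 h3.le)

/-- Three nonvanishing paths, starting in a common direction and pairwise never in opposite
directions, cannot end at numbers summing to zero. -/
theorem add_add_ne_zero_of_path {f g h : ℝ → ℂ} (hf : Continuous f) (hg : Continuous g)
    (hh : Continuous h)
    (hf0 : ∀ s ∈ Set.Icc (0 : ℝ) 1, f s ≠ 0) (hg0 : ∀ s ∈ Set.Icc (0 : ℝ) 1, g s ≠ 0)
    (hgf : ∀ s ∈ Set.Icc (0 : ℝ) 1, g s / f s ∈ Complex.slitPlane)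
    (hhf : ∀ s ∈ Set.Icc (0 : ℝ) 1, h s / f s ∈ Complex.slitPlane)
    (hhg : ∀ s ∈ Set.Icc (0 : ℝ) 1, h s / g s ∈ Complex.slitPlane)
    (hgf_arg : (g 0 / f 0).arg = 0) (hhf_arg : (h 0 / f 0).arg = 0)
    (hhg_arg : (h 0 / g 0).arg = 0) :
    f 1 + g 1 + h 1 ≠ 0 := by
  set φ : ℝ → ℝ := fun s => (g s / f s).arg + (h s / g s).arg - (h s / f s).arg with hφ
  have hcont : ContinuousOn φ (Set.Icc 0 1) := by
    refine ContinuousOn.sub (ContinuousOn.add ?_ ?_) ?_ <;> intro s hs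
    · exact (Complex.continuousAt_arg (hgf s hs)).comp_continuousWithinAt
        (f := fun s => g s / f s) (hg.continuousWithinAt.div hf.continuousWithinAt (hf0 s hs))
    · exact (Complex.continuousAt_arg (hhg s hs)).comp_continuousWithinAt
        (f := fun s => h s / g s) (hh.continuousWithinAt.div hg.continuousWithinAt (hg0 s hs))
    · exact (Complex.continuousAt_arg (hhf s hs)).comp_continuousWithinAt
        (f := fun s => h s / f s) (hh.continuousWithinAt.div hf.continuousWithinAt (hf0 s hs))
  have hangle : ∀ s ∈ Set.Icc (0 : ℝ) 1, ((φ s : ℝ) : Real.Angle) = 0 := by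
    intro s hs
    have hmul : g s / f s * (h s / g s) = h s / f s := by
      have := hf0 s hs
      have := hg0 s hs
      field_simp
    rw [hφ, Real.Angle.coe_sub, Real.Angle.coe_add,
      ← Complex.arg_mul_coe_angle (Complex.slitPlane_ne_zero (hgf s hs))
        (Complex.slitPlane_ne_zero (hhg s hs)), hmul, sub_self]
  have hφ0 : φ 0 = 0 := by simp [hφ, hgf_arg, hhf_arg, hhg_arg]
  have h01 : (0 : ℝ) ≤ 1 := zero_le_one
  have hφ1 : φ 1 = 0 := by
    obtain ⟨n, hn⟩ := Real.Angle.coe_eq_zero_iff.1 (hangle 1 ⟨h01, le_rfl⟩)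
    rw [zsmul_eq_mul] at hn
    have hpi := Real.pi_pos
    rcases lt_trichotomy n 0 with hlt | heq | hgt
    · have : (n : ℝ) ≤ -1 := by exact_mod_cast Int.le_sub_one_of_lt hlt
      obtain ⟨s, hs, hsφ⟩ := intermediate_value_Icc' h01 hcont
        (show -Real.pi ∈ Set.Icc (φ 1) (φ 0) from ⟨by nlinarith, by linarith⟩)
      have := hangle s hs
      rw [hsφ, Real.Angle.coe_neg, neg_eq_zero] at this
      exact absurd this Real.Angle.pi_ne_zero
    · rw [← hn, heq]; simp
    · have : (1 : ℝ) ≤ n := by exact_mod_cast hgt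
      obtain ⟨s, hs, hsφ⟩ := intermediate_value_Icc h01 hcont
        (show Real.pi ∈ Set.Icc (φ 0) (φ 1) from ⟨by linarith, by nlinarith⟩)
      have := hangle s hs
      rw [hsφ] at this
      exact absurd this Real.Angle.pi_ne_zero
  have hone : (1 : ℝ) ∈ Set.Icc (0 : ℝ) 1 := ⟨h01, le_rfl⟩
  have hf1 := hf0 1 hone
  have hg1 := hg0 1 hone
  have hdiv : h 1 / f 1 / (g 1 / f 1) = h 1 / g 1 := by field_simp
  have key := add_add_ne_zero_of_arg_add_arg_eq (hgf 1 hone) (hhf 1 hone)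
    (by rw [hdiv]; linarith [hφ1])
  intro hsum
  apply key
  have : 1 + g 1 / f 1 + h 1 / f 1 = (f 1 + g 1 + h 1) / f 1 := by field_simp
  rw [this, hsum, zero_div]

theorem div_mem_slitPlane_of_im_neg {p q m : ℂ} (hp : (p * m).im < 0) (hq : (q * m).im < 0) :
    p / q ∈ Complex.slitPlane := by
  rw [Complex.mem_slitPlane_iff_not_le_zero]
  intro hle
  have hq0 : q ≠ 0 := by rintro rfl; simp at hq
  obtain ⟨hre, him⟩ := Complex.le_def.1 hle
  have hr : p / q = ((p / q).re : ℂ) := Complex.ext (by simp) (by simpa using him)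
  have hpq : p * m = ((p / q).re : ℂ) * (q * m) := by
    rw [← hr]; field_simp
  rw [hpq, Complex.im_ofReal_mul] at hp
  exact absurd (mul_nonneg_of_nonpos_of_nonpos hre hq.le) (not_le.2 hp)

theorem indepSum_ofReal_pos (G : SimpleGraph V) {r : V → ℝ} (hr : ∀ i, 0 < r i)
    (S : Finset V) : ∃ c : ℝ, 0 < c ∧ indepSum G (fun i => (r i : ℂ)) S = c := by
  refine ⟨∑ T ∈ S.powerset, if ∀ a ∈ T, ∀ b ∈ T, ¬ G.Adj a b then ∏ a ∈ T, r a else 0, ?_, ?_⟩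
  · refine Finset.sum_pos' (fun T _ => ?_) ⟨∅, Finset.empty_mem_powerset S, by simp⟩
    split_ifs
    · exact Finset.prod_nonneg fun a _ => (hr a).le
    · exact le_rfl
  · simp only [indepSum]
    push_cast [apply_ite Complex.ofReal]
    rfl

theorem continuous_indepSum (G : SimpleGraph V) {X : Type*} [TopologicalSpace X]
    {x : X → V → ℂ} (hx : ∀ i, Continuous fun s => x s i) (S : Finset V) :
    Continuous fun s => indepSum G (x s) S := by
  refine continuous_finsetSum _ fun T _ => ?_
  split_ifs
  · exact continuous_finsetProd _ fun a _ => hx a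
  · exact continuous_const

/-- If every positive reweighting of `S` has nonvanishing independence polynomial at `z`, the two
terms of the vertex-deletion recurrence never point in opposite directions. -/
theorem indepSum_ratio_mem_slitPlane (G : SimpleGraph V) {t : V → ℝ} (ht : ∀ i, 0 < t i) {z : ℂ}
    (hz : z ≠ 0) {S : Finset V} {u : V} (hu : u ∈ S)
    (hne : ∀ t' : V → ℝ, (∀ i, 0 < t' i) → indepSum G (fun i => t' i * z) S ≠ 0)
    (herase : indepSum G (fun i => t i * z) (S.erase u) ≠ 0)
    (hdel : indepSum G (fun i => t i * z) (deleteClosedNbhd G S u) ≠ 0) :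
    t u * z * indepSum G (fun i => t i * z) (deleteClosedNbhd G S u) /
      indepSum G (fun i => t i * z) (S.erase u) ∈ Complex.slitPlane := by
  rw [Complex.mem_slitPlane_iff_not_le_zero]
  intro hle
  set a := indepSum G (fun i => t i * z) (S.erase u) with ha
  set b := indepSum G (fun i => t i * z) (deleteClosedNbhd G S u) with hb
  have htu : (t u : ℂ) ≠ 0 := by exact_mod_cast (ht u).ne'
  have hq0 : t u * z * b / a ≠ 0 := div_ne_zero (mul_ne_zero (mul_ne_zero htu hz) hdel) herase
  obtain ⟨hre, him⟩ := Complex.le_def.1 hle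
  set r := (t u * z * b / a).re with hr
  have hqr : t u * z * b / a = (r : ℂ) := Complex.ext (by simp [hr]) (by simpa using him)
  have hr0 : r ≠ 0 := fun h => hq0 (by rw [hqr, h, Complex.ofReal_zero])
  have hrneg : r < 0 := lt_of_le_of_ne (by simpa using hre) hr0
  refine hne (Function.update t u (t u / -r)) (fun i => ?_) ?_
  · rcases eq_or_ne i u with rfl | hi
    · simpa using div_pos (ht i) (neg_pos.2 hrneg)
    · simpa [hi] using ht i
  · rw [indepSum_eq_erase_add G _ hu,
      indepSum_congr G (S := S.erase u) (y := fun i => t i * z)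
        (fun i hi => by simp [(Finset.mem_erase.1 hi).1]),
      indepSum_congr G (S := deleteClosedNbhd G S u) (y := fun i => t i * z)
        (fun i hi => by simp [(Finset.mem_filter.1 hi).2.1]), ← ha, ← hb]
    have hrc : (r : ℂ) ≠ 0 := by exact_mod_cast hr0
    have hmul : t u * z * b = r * a := (div_eq_iff herase).1 hqr
    simp only [Function.update_self]
    push_cast
    field_simp
    linear_combination -hmul

/-- For adjacent `u`, `v` in a claw-free graph, the independence polynomials left after deleting
either closed neighbourhood never point in opposite directions. -/
theorem ClawFree.indepSum_deleteClosedNbhd_ratio_mem_slitPlane {G : SimpleGraph V}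
    (hG : ClawFree G) {t : V → ℝ} (ht : ∀ i, 0 < t i) {z : ℂ} (hz : 0 < z.im) {S : Finset V} {u v : V}
    (hu : u ∈ S) (hv : v ∈ S) (huv : G.Adj u v) (hne : ∀ T ⊂ S, indepSum G (fun i => t i * z) T ≠ 0) :
    t v * z * indepSum G (fun i => t i * z) (deleteClosedNbhd G S v) /
      (t u * z * indepSum G (fun i => t i * z) (deleteClosedNbhd G S u)) ∈
        Complex.slitPlane := by
  have hz0 : z ≠ 0 := by rintro rfl; simp at hz
  set F := indepSum G (fun i => t i * z) with hF
  have hssub : ∀ w ∈ S, deleteClosedNbhd G S w ⊂ S := fun w hw =>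
    lt_of_le_of_lt (deleteClosedNbhd_subset_erase G S w) (Finset.erase_ssubset hw)
  have hU := ((hG.isSimplicialClique S huv).ratio_im hG ht hz _ _
    (fun T hT => hne T (lt_of_le_of_lt hT (hssub v hv)))).2
  have hV := ((hG.isSimplicialClique S huv.symm).ratio_im hG ht hz _ _
    (fun T hT => hne T (lt_of_le_of_lt hT (hssub u hu)))).2
  have hset : deleteClosedNbhd G S u \ (deleteClosedNbhd G S u).filter (G.Adj v) =
      deleteClosedNbhd G S v \ (deleteClosedNbhd G S v).filter (G.Adj u) := by
    ext b
    simp only [deleteClosedNbhd, Finset.mem_sdiff, Finset.mem_filter]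
    have h1 : b = u → G.Adj v b := by rintro rfl; exact huv.symm
    have h2 : b = v → G.Adj u b := by rintro rfl; exact huv
    tauto
  rw [hset] at hV
  rw [← hF] at hU hV
  set d := F (deleteClosedNbhd G S v \ (deleteClosedNbhd G S v).filter (G.Adj u))
  refine div_mem_slitPlane_of_im_neg (m := (d * z ^ 2)⁻¹) ?_ ?_
  · have : t v * z * F (deleteClosedNbhd G S v) * (d * z ^ 2)⁻¹ =
        t v * (F (deleteClosedNbhd G S v) / d / z) := by
      field_simp
    rw [this, Complex.im_ofReal_mul]
    exact mul_neg_of_pos_of_neg (ht v) hU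
  · have : t u * z * F (deleteClosedNbhd G S u) * (d * z ^ 2)⁻¹ =
        t u * (F (deleteClosedNbhd G S u) / d / z) := by
      field_simp
    rw [this, Complex.im_ofReal_mul]
    exact mul_neg_of_pos_of_neg (ht u) hV

theorem ClawFree.indepSum_ne_zero {G : SimpleGraph V} (hG : ClawFree G) (S : Finset V) :
    ∀ t : V → ℝ, (∀ i, 0 < t i) → ∀ z : ℂ, 0 < z.im → indepSum G (fun i => t i * z) S ≠ 0 := by
  induction S using Finset.strongInduction with
  | H S ih =>
    intro t ht z hz
    rcases S.eq_empty_or_nonempty with rfl | ⟨u, hu⟩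
    · simp [indepSum_empty]
    by_cases hnbr : ∃ v ∈ S, G.Adj u v
    · obtain ⟨v, hv, huv⟩ := hnbr
      have hvu : v ∈ S.erase u := Finset.mem_erase.2 ⟨huv.ne', hv⟩
      have huv' : u ∈ S.erase v := Finset.mem_erase.2 ⟨huv.ne, hu⟩
      set γ : ℝ → ℂ := fun s => 1 + s * (z - 1) with hγ
      have hγc : Continuous γ := by fun_prop
      have hγ0 : γ 0 = 1 := by simp [hγ]
      have hγ1 : γ 1 = z := by simp [hγ]
      have hγim : ∀ s, 0 < s → 0 < (γ s).im := fun s hs => by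
        simpa [hγ] using mul_pos hs hz
      have hFc : ∀ T, Continuous fun s => indepSum G (fun i => t i * γ s) T :=
        continuous_indepSum G fun i => by fun_prop
      have hzero : ∀ T, ∃ c : ℝ, 0 < c ∧ indepSum G (fun i => t i * γ 0) T = c := fun T => by
        simpa [hγ0] using indepSum_ofReal_pos G ht T
      have hssub : ∀ w ∈ S, deleteClosedNbhd G S w ⊂ S := fun w hw =>
        lt_of_le_of_lt (deleteClosedNbhd_subset_erase G S w) (Finset.erase_ssubset hw)
      have hvE : S.erase v ⊂ S := Finset.erase_ssubset hv
      have huE : S.erase u ⊂ S := Finset.erase_ssubset hu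
      have hE : (S.erase v).erase u ⊂ S :=
        lt_of_le_of_lt (Finset.erase_subset _ _) hvE
      have hne : ∀ T ⊂ S, ∀ s ∈ Set.Icc (0 : ℝ) 1, indepSum G (fun i => t i * γ s) T ≠ 0 := by
        intro T hT s hs
        rcases hs.1.eq_or_lt with rfl | hs0
        · obtain ⟨c, hc, hc'⟩ := hzero T
          rw [hc']
          exact_mod_cast hc.ne'
        · exact ih T hT t ht _ (hγim s hs0)
      have hγne : ∀ s ∈ Set.Icc (0 : ℝ) 1, γ s ≠ 0 := by
        intro s hs h
        rcases hs.1.eq_or_lt with rfl | hs0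
        · simp [hγ0] at h
        · simpa [h] using hγim s hs0
      have htne : ∀ i, (t i : ℂ) ≠ 0 := fun i => by exact_mod_cast (ht i).ne'
      obtain ⟨a, ha, ha'⟩ := hzero ((S.erase v).erase u)
      obtain ⟨b, hb, hb'⟩ := hzero (deleteClosedNbhd G S u)
      obtain ⟨c, hc, hc'⟩ := hzero (deleteClosedNbhd G S v)
      have hgf_zero : t u * γ 0 * indepSum G (fun i => t i * γ 0) (deleteClosedNbhd G S u) /
          indepSum G (fun i => t i * γ 0) ((S.erase v).erase u) = ((t u * b / a : ℝ) : ℂ) := by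
        rw [ha', hb', hγ0]; push_cast; ring
      have hhf_zero : t v * γ 0 * indepSum G (fun i => t i * γ 0) (deleteClosedNbhd G S v) /
          indepSum G (fun i => t i * γ 0) ((S.erase v).erase u) = ((t v * c / a : ℝ) : ℂ) := by
        rw [ha', hc', hγ0]; push_cast; ring
      have hhg_zero : t v * γ 0 * indepSum G (fun i => t i * γ 0) (deleteClosedNbhd G S v) /
          (t u * γ 0 * indepSum G (fun i => t i * γ 0) (deleteClosedNbhd G S u)) =
          ((t v * c / (t u * b) : ℝ) : ℂ) := by
        rw [hb', hc', hγ0]; push_cast; ring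
      have htu := ht u
      have htv := ht v
      have hpath := add_add_ne_zero_of_path
        (f := fun s => indepSum G (fun i => t i * γ s) ((S.erase v).erase u))
        (g := fun s => t u * γ s * indepSum G (fun i => t i * γ s) (deleteClosedNbhd G S u))
        (h := fun s => t v * γ s * indepSum G (fun i => t i * γ s) (deleteClosedNbhd G S v))
        (hFc _) ((continuous_const.mul hγc).mul (hFc _)) ((continuous_const.mul hγc).mul (hFc _))
        (hne _ hE)
        (fun s hs => mul_ne_zero (mul_ne_zero (htne u) (hγne s hs)) (hne _ (hssub u hu) s hs))
        (fun s hs => by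
          rcases hs.1.eq_or_lt with rfl | hs0
          · rw [hgf_zero, Complex.ofReal_mem_slitPlane]; positivity
          · have := indepSum_ratio_mem_slitPlane G ht (hγne s hs) huv'
              (fun t' ht' => ih _ hvE t' ht' _ (hγim s hs0)) (hne _ hE s hs)
              (by rw [deleteClosedNbhd_erase S huv]; exact hne _ (hssub u hu) s hs)
            rwa [deleteClosedNbhd_erase S huv] at this)
        (fun s hs => by
          rcases hs.1.eq_or_lt with rfl | hs0
          · rw [hhf_zero, Complex.ofReal_mem_slitPlane]; positivity
          · have := indepSum_ratio_mem_slitPlane G ht (hγne s hs) hvu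
              (fun t' ht' => ih _ huE t' ht' _ (hγim s hs0))
              (by rw [Finset.erase_right_comm]; exact hne _ hE s hs)
              (by rw [deleteClosedNbhd_erase S huv.symm]; exact hne _ (hssub v hv) s hs)
            rwa [deleteClosedNbhd_erase S huv.symm, Finset.erase_right_comm] at this)
        (fun s hs => by
          rcases hs.1.eq_or_lt with rfl | hs0
          · rw [hhg_zero, Complex.ofReal_mem_slitPlane]; positivity
          · exact hG.indepSum_deleteClosedNbhd_ratio_mem_slitPlane ht (hγim s hs0) hu hv huv
              fun T hT => hne T hT s hs)
        (by rw [hgf_zero]; exact Complex.arg_ofReal_of_nonneg (by positivity))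
        (by rw [hhf_zero]; exact Complex.arg_ofReal_of_nonneg (by positivity))
        (by rw [hhg_zero]; exact Complex.arg_ofReal_of_nonneg (by positivity))
      rw [indepSum_eq_erase_add G _ hv, indepSum_eq_erase_add G _ huv',
        deleteClosedNbhd_erase S huv]
      simpa only [hγ1] using hpath
    · push Not at hnbr
      have hdel : deleteClosedNbhd G S u = S.erase u := by
        ext b
        simp only [deleteClosedNbhd, Finset.mem_filter, Finset.mem_erase]
        have := hnbr b
        tauto
      rw [indepSum_eq_erase_add G _ hu, hdel, ← one_add_mul]
      refine mul_ne_zero (fun h => ?_) (ih _ (Finset.erase_ssubset hu) t ht z hz)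
      have := congrArg Complex.im h
      simp only [Complex.add_im, Complex.one_im, Complex.im_ofReal_mul, Complex.zero_im,
        zero_add] at this
      exact (mul_pos (ht u) hz).ne' this

theorem aeval_diagRestrict_indepPoly [Fintype V] (G : SimpleGraph V) (t : V → ℝ) (z : ℂ) :
    Polynomial.aeval z (diagRestrict (indepPoly G) t) =
      indepSum G (fun i => t i * z) Finset.univ := by
  simp only [diagRestrict, indepPoly, indepSum, Finset.sum_filter, Finset.powerset_univ, map_sum]
  refine Finset.sum_congr rfl fun T _ => ?_
  split_ifs <;> simp

end ClawFreeIndependence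

/-- For any claw-free finite simple graph `G`, the multivariate independence polynomial `I(G)`
is same-phase stable. -/
theorem indepPoly_samePhaseStable_of_clawFree {V : Type*} [Fintype V]
    (G : SimpleGraph V) (hclaw : ClawFree G) :
    SamePhaseStable (indepPoly G) := by
  refine fun t ht => Or.inr fun z hz => ?_
  have hupper : ∀ w : ℂ, 0 < w.im →
      Polynomial.aeval w (diagRestrict (indepPoly G) t) ≠ 0 := fun w hw => by
    rw [aeval_diagRestrict_indepPoly]
    exact hclaw.indepSum_ne_zero _ t ht w hw
  rcases lt_trichotomy z.im 0 with hlt | heq | hgt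
  · refine absurd ?_ (hupper (starRingEnd ℂ z) (by simpa using hlt))
    rw [Polynomial.aeval_conj, hz, map_zero]
  · exact heq
  · exact absurd hz (hupper z hgt)
end

section
/- For any connected finite simple graph G, the multivariate independence polynomial I(G) is real stable if and only if G is a complete graph. -/
open MvPolynomial
open scoped Classical

/-- If `G` is connected and not complete, it has an induced path on three vertices. -/
lemma SimpleGraph.Connected.exists_induced_path_three {V : Type*} {G : SimpleGraph V}
    (hconn : G.Connected) (hG : ¬ ∀ u v : V, u ≠ v → G.Adj u v) :
    ∃ a b c : V, G.Adj a b ∧ G.Adj b c ∧ a ≠ c ∧ ¬ G.Adj a c := by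
  by_contra! h
  have key : ∀ {u v : V}, G.Walk u v → u ≠ v → G.Adj u v := by
    intro u v p
    induction p with
    | nil => exact fun hne => absurd rfl hne
    | @cons x y z hxy q ih =>
      intro hxz
      by_cases hyz : y = z
      · exact hyz ▸ hxy
      · exact h x y z hxy (ih hyz) hxz
  exact hG fun u v huv => (hconn.preconnected u v).elim fun p => key p huv

lemma aeval_indepPoly {V : Type*} [Fintype V] (G : SimpleGraph V) (z : V → ℂ) :
    aeval z (indepPoly G) =
      ∑ S ∈ Finset.univ.filter (fun S : Finset V => ∀ a ∈ S, ∀ b ∈ S, ¬ G.Adj a b),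
        ∏ a ∈ S, z a := by
  simp [indepPoly]

/-- The value of `I(G - b)` at `z`. -/
noncomputable def indepDelete {V : Type*} [Fintype V] (G : SimpleGraph V) (b : V)
    (z : V → ℂ) : ℂ :=
  ∑ S ∈ Finset.univ.filter
      (fun S : Finset V => (∀ a ∈ S, ∀ c ∈ S, ¬ G.Adj a c) ∧ b ∉ S), ∏ a ∈ S, z a

/-- The value of `I(G - N[b])` at `z`. -/
noncomputable def indepLink {V : Type*} [Fintype V] (G : SimpleGraph V) (b : V)
    (z : V → ℂ) : ℂ :=
  ∑ S ∈ Finset.univ.filter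
      (fun S : Finset V => (∀ a ∈ S, ∀ c ∈ S, ¬ G.Adj a c) ∧ b ∈ S), ∏ a ∈ S.erase b, z a

/-- The independence polynomial is affine in the variable of `b`. -/
lemma aeval_update_indepPoly {V : Type*} [Fintype V] (G : SimpleGraph V) (b : V)
    (z : V → ℂ) (t : ℂ) :
    aeval (Function.update z b t) (indepPoly G) = indepDelete G b z + t * indepLink G b z := by
  rw [aeval_indepPoly, ← Finset.sum_filter_not_add_sum_filter _ (fun S => b ∈ S),
    Finset.filter_filter, Finset.filter_filter, indepDelete, indepLink, Finset.mul_sum]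
  congr 1
  · refine Finset.sum_congr rfl fun S hS => Finset.prod_congr rfl fun v hv => ?_
    have hb : b ∉ S := (Finset.mem_filter.1 hS).2.2
    exact Function.update_of_ne (ne_of_mem_of_not_mem hv hb) _ _
  · refine Finset.sum_congr rfl fun S hS => ?_
    rw [← Finset.mul_prod_erase S _ (Finset.mem_filter.1 hS).2.2, Function.update_self]
    congr 1
    exact Finset.prod_congr rfl fun v hv =>
      Function.update_of_ne (Finset.ne_of_mem_erase hv) _ _

lemma continuous_indepDelete {V : Type*} [Fintype V] (G : SimpleGraph V) (b : V) :
    Continuous (indepDelete G b) := by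
  unfold indepDelete
  fun_prop

lemma continuous_indepLink {V : Type*} [Fintype V] (G : SimpleGraph V) (b : V) :
    Continuous (indepLink G b) := by
  unfold indepLink
  fun_prop

lemma indepDelete_of_support {V : Type*} [Fintype V] {G : SimpleGraph V} {a b c : V}
    (hab : G.Adj a b) (hbc : G.Adj b c) (hne : a ≠ c) (hac : ¬ G.Adj a c) {z : V → ℂ}
    (hz : ∀ v, v ≠ a → v ≠ c → z v = 0) :
    indepDelete G b z = (1 + z a) * (1 + z c) := by
  rw [← Finset.prod_pair (f := fun v => 1 + z v) hne, Finset.prod_one_add, indepDelete]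
  symm
  apply Finset.sum_subset
  · intro S hS
    have hS' : ∀ v ∈ S, v = a ∨ v = c := fun v hv => by
      simpa using Finset.mem_powerset.1 hS hv
    refine Finset.mem_filter.2 ⟨Finset.mem_univ _, fun u hu v hv => ?_, fun hb => ?_⟩
    · have hca : ¬ G.Adj c a := fun h => hac h.symm
      rcases hS' u hu with rfl | rfl <;> rcases hS' v hv with rfl | rfl <;> simp [*]
    · rcases hS' b hb with rfl | rfl
      · exact G.irrefl hab
      · exact G.irrefl hbc
  · intro S _ hS
    rw [Finset.mem_powerset, Finset.not_subset] at hS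
    obtain ⟨v, hv, hvac⟩ := hS
    simp only [Finset.mem_insert, Finset.mem_singleton, not_or] at hvac
    exact Finset.prod_eq_zero hv (hz v hvac.1 hvac.2)

lemma indepLink_of_support {V : Type*} [Fintype V] {G : SimpleGraph V} {a b c : V}
    (hab : G.Adj a b) (hbc : G.Adj b c) {z : V → ℂ}
    (hz : ∀ v, v ≠ a → v ≠ c → z v = 0) :
    indepLink G b z = 1 := by
  rw [indepLink, Finset.sum_eq_single {b}]
  · simp
  · intro S hS hSb
    obtain ⟨-, hind, hb⟩ := Finset.mem_filter.1 hS
    obtain ⟨v, hv, hvb⟩ : ∃ v ∈ S, v ≠ b := by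
      by_contra! h
      exact hSb (Finset.eq_singleton_iff_unique_mem.2 ⟨hb, h⟩)
    refine Finset.prod_eq_zero (Finset.mem_erase.2 ⟨hvb, hv⟩) (hz v ?_ ?_)
    · rintro rfl
      exact hind v hv b hb hab
    · rintro rfl
      exact hind b hb v hv hbc
  · intro h
    simp at h

/-- An induced path `a - b - c` forces a zero of the independence polynomial in the open upper
half-plane: near `z a = z c = -2 + i`, `z b = 2i`, and all other variables `0`. -/
lemma exists_aeval_indepPoly_eq_zero {V : Type*} [Fintype V] {G : SimpleGraph V} {a b c : V}
    (hab : G.Adj a b) (hbc : G.Adj b c) (hne : a ≠ c) (hac : ¬ G.Adj a c) :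
    ∃ z : V → ℂ, (∀ v, 0 < (z v).im) ∧ aeval z (indepPoly G) = 0 := by
  let w : ℝ → V → ℂ := fun ε v => if v = a ∨ v = c then -2 + Complex.I else ε * Complex.I
  have hw : Continuous w := by
    refine continuous_pi fun v => ?_
    by_cases h : v = a ∨ v = c
    · simpa only [w, if_pos h] using continuous_const
    · simp only [w, if_neg h]
      fun_prop
  have hsupp : ∀ v, v ≠ a → v ≠ c → w 0 v = 0 := fun v hva hvc => by simp [w, hva, hvc]
  have hlink : indepLink G b (w 0) = 1 := indepLink_of_support hab hbc hsupp
  have hdelete : indepDelete G b (w 0) = -2 * Complex.I := by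
    rw [indepDelete_of_support hab hbc hne hac hsupp]
    simp only [w, true_or, or_true, if_true]
    linear_combination Complex.I_sq
  have hcl : Continuous fun ε => indepLink G b (w ε) := (continuous_indepLink G b).comp hw
  have hcd : Continuous fun ε => indepDelete G b (w ε) := (continuous_indepDelete G b).comp hw
  have hlink_ne : ∀ᶠ ε in nhds (0 : ℝ), indepLink G b (w ε) ≠ 0 :=
    hcl.continuousAt.eventually_ne (by simp [hlink])
  have him : ∀ᶠ ε in nhds (0 : ℝ),
      0 < (-(indepDelete G b (w ε)) / indepLink G b (w ε)).im := by
    have hcont : ContinuousAt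
        (fun ε => (-(indepDelete G b (w ε)) / indepLink G b (w ε)).im) 0 :=
      Complex.continuous_im.continuousAt.comp
        (hcd.neg.continuousAt.div hcl.continuousAt (by simp [hlink]))
    exact hcont.eventually_const_lt (by simp [hlink, hdelete])
  obtain ⟨ε, ⟨hB, ht⟩, hε⟩ :=
    (((hlink_ne.and him).filter_mono nhdsWithin_le_nhds).and
      (self_mem_nhdsWithin : Set.Ioi (0 : ℝ) ∈ nhdsWithin 0 (Set.Ioi 0))).exists
  refine ⟨Function.update (w ε) b (-(indepDelete G b (w ε)) / indepLink G b (w ε)),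
    fun v => ?_, ?_⟩
  · by_cases hvb : v = b
    · subst hvb
      simpa only [Function.update_self] using ht
    · rw [Function.update_of_ne hvb]
      by_cases h : v = a ∨ v = c
      · simp [w, h]
      · simpa [w, h] using hε
  · rw [aeval_update_indepPoly, div_mul_cancel₀ _ hB, add_neg_cancel]

lemma indepPoly_ne_zero {V : Type*} [Fintype V] (G : SimpleGraph V) : indepPoly G ≠ 0 := by
  intro h
  have h0 := aeval_indepPoly G 0
  rw [h, map_zero, Finset.sum_eq_single ∅] at h0
  · simp at h0
  · intro S _ hS
    obtain ⟨v, hv⟩ := Finset.nonempty_iff_ne_empty.2 hS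
    exact Finset.prod_eq_zero hv rfl
  · simp

/-- The independence polynomial of a complete graph is `1 + ∑ v, x_v`. -/
lemma aeval_indepPoly_of_complete {V : Type*} [Fintype V] {G : SimpleGraph V}
    (hG : ∀ u v : V, u ≠ v → G.Adj u v) (z : V → ℂ) :
    aeval z (indepPoly G) = 1 + ∑ v, z v := by
  have hfilter : Finset.univ.filter (fun S : Finset V => ∀ a ∈ S, ∀ b ∈ S, ¬ G.Adj a b) =
      insert ∅ (Finset.univ.image fun v : V => ({v} : Finset V)) := by
    ext S
    simp only [Finset.mem_filter, Finset.mem_univ, true_and, Finset.mem_insert,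
      Finset.mem_image]
    constructor
    · intro h
      rcases S.eq_empty_or_nonempty with rfl | ⟨v, hv⟩
      · exact Or.inl rfl
      · refine Or.inr ⟨v, (Finset.eq_singleton_iff_unique_mem.2 ⟨hv, fun u hu => ?_⟩).symm⟩
        by_contra huv
        exact h u hu v hv (hG u v huv)
    · rintro (rfl | ⟨v, rfl⟩) <;> simp
  rw [aeval_indepPoly, hfilter, Finset.sum_insert (by simp),
    Finset.sum_image fun u _ v _ h => Finset.singleton_injective h]
  simp

/-- For a connected finite simple graph `G`, the multivariate independence polynomial `I(G)` is
real stable if and only if `G` is a complete graph. -/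
theorem indepPoly_realStable_iff_complete {V : Type*} [Fintype V]
    (G : SimpleGraph V) (hconn : G.Connected) :
    RealStable (indepPoly G) ↔ ∀ u v : V, u ≠ v → G.Adj u v := by
  constructor
  · rintro (h | h)
    · exact absurd h (indepPoly_ne_zero G)
    · by_contra hG
      obtain ⟨a, b, c, hab, hbc, hne, hac⟩ := hconn.exists_induced_path_three hG
      obtain ⟨z, hz, hz0⟩ := exists_aeval_indepPoly_eq_zero hab hbc hne hac
      exact h z hz hz0
  · intro hG
    refine Or.inr fun z hz h => ?_
    rw [aeval_indepPoly_of_complete hG] at h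
    have him := congrArg Complex.im h
    have := hconn.nonempty
    have hpos : 0 < ∑ v, (z v).im := Finset.sum_pos (fun v _ => hz v) Finset.univ_nonempty
    simp at him
    exact hpos.ne' him
end

section
/- Let G be a finite simple graph and v a vertex of G of degree at least one, and let K_v be the set of edges of G incident to v, viewed as a set of vertices of the line graph L(G). Then K_v is a simplicial clique of L(G). In particular, since line graphs are claw-free, L(G) is a simplicial graph. -/
open scoped Classical

/-- `K` is a simplicial clique of `H`: `K` is a clique, and for every `u ∈ K` the set
`N[u] ∖ K` (the closed neighborhood of `u` minus `K`) induces a clique in `H`. -/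
def IsSimplicialClique {α : Type*} (H : SimpleGraph α) (K : Finset α) : Prop :=
  H.IsClique ↑K ∧ ∀ u ∈ K, H.IsClique ({w | w = u ∨ H.Adj u w} \ ↑K)

/-- A graph is simplicial if it is claw-free and contains a nonempty simplicial clique. -/
def IsSimplicialGraph {α : Type*} (H : SimpleGraph α) : Prop :=
  ClawFree H ∧ ∃ K : Finset α, K.Nonempty ∧ IsSimplicialClique H K

namespace SimpleGraph

variable {V : Type*} {G : SimpleGraph V}

/-- Distinct edges through a common vertex are adjacent in the line graph. -/
lemma lineGraph_adj_of_mem {e f : G.edgeSet} {x : V} (hne : e ≠ f)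
    (he : x ∈ (e : Sym2 V)) (hf : x ∈ (f : Sym2 V)) : G.lineGraph.Adj e f :=
  lineGraph_adj_iff_exists.2 ⟨hne, x, he, hf⟩

/-- The line graph neighbors of an edge `s(a, b)` pass through `a` or `b`. -/
lemma mem_or_mem_of_lineGraph_adj {e f : G.edgeSet} {a b : V} (he : (e : Sym2 V) = s(a, b))
    (h : G.lineGraph.Adj e f) : a ∈ (f : Sym2 V) ∨ b ∈ (f : Sym2 V) := by
  obtain ⟨-, x, hxe, hxf⟩ := lineGraph_adj_iff_exists.1 h
  rw [he, Sym2.mem_iff] at hxe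
  rcases hxe with rfl | rfl
  exacts [.inl hxf, .inr hxf]

lemma clawFree_lineGraph (G : SimpleGraph V) : ClawFree G.lineGraph := by
  refine ⟨fun φ => ?_⟩
  obtain ⟨a, b, hab⟩ : ∃ a b, (φ (.inl 0) : Sym2 V) = s(a, b) :=
    Sym2.ind (fun a b => ⟨a, b, rfl⟩) (φ (.inl 0) : Sym2 V)
  have hleaf (i : Fin 3) : a ∈ (φ (.inr i) : Sym2 V) ∨ b ∈ (φ (.inr i) : Sym2 V) :=
    mem_or_mem_of_lineGraph_adj hab (φ.map_rel_iff.2 (by simp))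
  have hdisj (i j : Fin 3) (hij : i ≠ j) (x : V) (hi : x ∈ (φ (.inr i) : Sym2 V)) :
      x ∉ (φ (.inr j) : Sym2 V) := fun hj => by
    have hne : φ (.inr i) ≠ φ (.inr j) := φ.injective.ne (by simpa using hij)
    simpa using φ.map_rel_iff.1 (lineGraph_adj_of_mem hne hi hj)
  have h01 := hdisj 0 1 (by decide)
  have h02 := hdisj 0 2 (by decide)
  have h12 := hdisj 1 2 (by decide)
  rcases hleaf 0 with h0 | h0 <;> rcases hleaf 1 with h1 | h1 <;>
    rcases hleaf 2 with h2 | h2 <;>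
    first
    | exact h01 _ h0 h1
    | exact h02 _ h0 h2
    | exact h12 _ h1 h2

/-- A finite set consisting of all edges incident to `v` is a simplicial clique of the line
graph. -/
lemma isSimplicialClique_lineGraph {v : V} {K : Finset G.edgeSet}
    (hK : ∀ e, e ∈ K ↔ v ∈ (e : Sym2 V)) : IsSimplicialClique G.lineGraph K := by
  refine ⟨fun e he f hf hne => lineGraph_adj_of_mem hne ((hK e).1 he) ((hK f).1 hf), ?_⟩
  intro u hu
  obtain ⟨x, hx⟩ := (hK u).1 hu
  have hmem : ∀ w ∈ {w | w = u ∨ G.lineGraph.Adj u w} \ (K : Set G.edgeSet),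
      x ∈ (w : Sym2 V) := by
    rintro w ⟨rfl | hw, hwK⟩
    · exact absurd hu hwK
    · exact (mem_or_mem_of_lineGraph_adj hx hw).resolve_left fun h => hwK ((hK w).2 h)
  exact fun e he f hf hne => lineGraph_adj_of_mem hne (hmem e he) (hmem f hf)

end SimpleGraph

/-- For a vertex `v` of `G` of degree at least one, the set `K_v` of edges of `G` incident
to `v` is a simplicial clique of the line graph `L(G)`; in particular, since line graphs are
claw-free, `L(G)` is a simplicial graph. -/
theorem lineGraph_isSimplicial {V : Type*} [Fintype V] [DecidableEq V]
    (G : SimpleGraph V) (v : V) (hv : ∃ w, G.Adj v w) :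
    IsSimplicialClique G.lineGraph
        (Finset.univ.filter (fun e : G.edgeSet => v ∈ (e : Sym2 V))) ∧
      ClawFree G.lineGraph ∧ IsSimplicialGraph G.lineGraph := by
  have hK := SimpleGraph.isSimplicialClique_lineGraph (G := G) (v := v)
    (K := Finset.univ.filter (fun e : G.edgeSet => v ∈ (e : Sym2 V))) (by simp)
  obtain ⟨w, hw⟩ := hv
  exact ⟨hK, G.clawFree_lineGraph, G.clawFree_lineGraph, _, ⟨⟨s(v, w), hw⟩, by simp⟩, hK⟩
end

section
/- Let G be a finite simple graph with at least one vertex; then its univariate independence polynomial has at least one real root, and denoting by λ₁(G) the largest such root: (1) for any vertex v of G such that G ∖ v still has at least one vertex, λ₁(G ∖ v) ≤ λ₁(G); (2) for any edge e of G, λ₁(G ∖ e) ≤ λ₁(G), where G ∖ e is G with the edge e deleted. -/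
open scoped Classical

/-- The univariate independence polynomial `I(G)(x) = Σ_{S independent} x^{|S|}`. -/
noncomputable def uIndepPoly {V : Type*} [Fintype V] (G : SimpleGraph V) : Polynomial ℝ :=
  ∑ S ∈ Finset.univ.filter (fun S : Finset V => ∀ a ∈ S, ∀ b ∈ S, ¬ G.Adj a b),
    Polynomial.X ^ S.card

/-- `λ₁(G)`, the largest real root of the univariate independence polynomial of `G`. -/
noncomputable def lam1 {V : Type*} [Fintype V] (G : SimpleGraph V) : ℝ :=
  sSup {x : ℝ | (uIndepPoly G).IsRoot x}

/-- No two members of `S` are adjacent in `G`. -/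
def IndepFinset {V : Type*} (G : SimpleGraph V) (S : Finset V) : Prop :=
  ∀ a ∈ S, ∀ b ∈ S, ¬ G.Adj a b

/-- The value at `x` of the independence polynomial of the subgraph of `G` induced on `W`. -/
noncomputable def indepEval {V : Type*} (G : SimpleGraph V) (W : Finset V) (x : ℝ) : ℝ :=
  ∑ S ∈ W.powerset with IndepFinset G S, x ^ S.card

section indepEval

variable {V : Type*} (G : SimpleGraph V)

theorem continuous_indepEval (W : Finset V) : Continuous (indepEval G W) := by
  unfold indepEval
  fun_prop

theorem one_le_indepEval (W : Finset V) {x : ℝ} (hx : 0 ≤ x) : 1 ≤ indepEval G W x := by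
  have h := Finset.single_le_sum (f := fun S : Finset V => x ^ S.card)
    (s := W.powerset.filter (IndepFinset G))
    (fun S _ => pow_nonneg hx _) (a := ∅) (by simp [IndepFinset])
  simpa [indepEval] using h

theorem neg_of_indepEval_nonpos {W : Finset V} {x : ℝ} (h : indepEval G W x ≤ 0) : x < 0 := by
  by_contra! hx
  linarith [one_le_indepEval G W hx]

theorem indepEval_empty (x : ℝ) : indepEval G ∅ x = 1 := by
  have h : IndepFinset G ∅ := by simp [IndepFinset]
  simp [indepEval, Finset.filter_singleton, h]

/-- Deletion–contraction at the vertex `v`. -/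
theorem indepEval_eq_erase_add {W : Finset V} {v : V} (hv : v ∈ W) (x : ℝ) :
    indepEval G W x = indepEval G (W.erase v) x +
      x * indepEval G ((W.erase v).filter fun w => ¬ G.Adj v w) x := by
  conv_lhs => rw [← Finset.insert_erase hv]
  unfold indepEval
  rw [Finset.sum_filter, Finset.sum_powerset_insert (Finset.notMem_erase v W),
    Finset.mul_sum]
  congr 1
  · rw [Finset.sum_filter]
  trans ∑ S ∈ (W.erase v).powerset with IndepFinset G (insert v S),
    x ^ (insert v S).card
  · rw [Finset.sum_filter]
  refine Finset.sum_congr ?_ fun S hS => ?_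
  · ext S
    simp only [Finset.mem_filter, Finset.mem_powerset, Finset.subset_iff, Finset.mem_erase]
    simp only [IndepFinset, Finset.mem_insert]
    constructor
    · grind
    · rintro ⟨h1, h2⟩
      refine ⟨fun w hw => (h1 hw).1, ?_⟩
      rintro a (rfl | ha) b (rfl | hb)
      · exact G.irrefl
      · exact (h1 hb).2
      · exact fun h => (h1 ha).2 h.symm
      · exact h2 a ha b hb
  · have hvS : v ∉ S := fun h => by
      have := (Finset.mem_powerset.1 (Finset.mem_filter.1 hS).1) h
      simp at this
    rw [Finset.card_insert_of_notMem hvS, pow_succ']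

/-- If the independence polynomial on `W'` is nonpositive at `z`, then on any larger vertex set
it is nonpositive somewhere to the right of `z`. -/
theorem exists_indepEval_nonpos_of_subset {W' W : Finset V} (hsub : W' ⊆ W) {z : ℝ}
    (hz : indepEval G W' z ≤ 0) : ∃ y, z ≤ y ∧ indepEval G W y ≤ 0 := by
  induction hn : W.card using Nat.strong_induction_on generalizing W' W z with
  | _ n ih =>
  by_cases hW : W' = W
  · exact ⟨z, le_rfl, hW ▸ hz⟩
  obtain ⟨v, hvW, hvW'⟩ := Finset.exists_of_ssubset (hsub.ssubset_of_ne hW)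
  have hcard : (W.erase v).card < n := hn ▸ Finset.card_erase_lt_of_mem hvW
  obtain ⟨z', hzz', hz'⟩ := ih _ hcard (Finset.subset_erase.2 ⟨hsub, hvW'⟩) hz rfl
  have hcomp : IsCompact (Set.Icc z' 0 ∩ {y | indepEval G (W.erase v) y ≤ 0}) :=
    isCompact_Icc.inter_right (isClosed_le (continuous_indepEval G _) continuous_const)
  obtain ⟨y, ⟨⟨hz'y, -⟩, hy⟩, hmax⟩ := hcomp.exists_isGreatest
    ⟨z', ⟨le_rfl, (neg_of_indepEval_nonpos G hz').le⟩, hz'⟩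
  have hy0 : y < 0 := neg_of_indepEval_nonpos G hy
  refine ⟨y, hzz'.trans hz'y, ?_⟩
  have hN : 0 ≤ indepEval G ((W.erase v).filter fun w => ¬ G.Adj v w) y := by
    by_contra! hneg
    have hev := (continuous_indepEval G _).continuousAt.eventually (gt_mem_nhds hneg)
    obtain ⟨y', hy', hyy'⟩ :=
      ((hev.filter_mono nhdsWithin_le_nhds).and (self_mem_nhdsWithin (s := Set.Ioi y))).exists
    obtain ⟨t, hy't, ht⟩ := ih _ hcard (Finset.filter_subset _ _) hy'.le rfl
    have hyt : y < t := lt_of_lt_of_le hyy' hy't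
    exact absurd (hmax ⟨⟨hz'y.trans hyt.le, (neg_of_indepEval_nonpos G ht).le⟩, ht⟩) hyt.not_ge
  rw [indepEval_eq_erase_add G hvW]
  have hy : indepEval G (W.erase v) y ≤ 0 := hy
  linarith [mul_nonpos_of_nonpos_of_nonneg hy0.le hN]

variable [Fintype V]

theorem eval_uIndepPoly (x : ℝ) : (uIndepPoly G).eval x = indepEval G Finset.univ x := by
  simp only [uIndepPoly, indepEval, IndepFinset, Polynomial.eval_finsetSum, Polynomial.eval_pow,
    Polynomial.eval_X, Finset.powerset_univ]

theorem eval_uIndepPoly_induce_ne (v : V) (x : ℝ) :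
    (uIndepPoly (G.induce {u : V | u ≠ v})).eval x = indepEval G (Finset.univ.erase v) x := by
  rw [eval_uIndepPoly]
  unfold indepEval
  refine Finset.sum_bij' (fun S _ => S.map (Function.Embedding.subtype _))
    (fun S _ => S.subtype (· ∈ {u : V | u ≠ v})) ?_ ?_ ?_ ?_ ?_
  · intro S hS
    rw [Finset.mem_filter] at hS
    simp only [Finset.mem_filter, Finset.mem_powerset, Finset.subset_iff, Finset.mem_map]
    simp only [IndepFinset, Finset.mem_map]
    refine ⟨?_, ?_⟩
    · rintro _ ⟨a, -, rfl⟩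
      exact Finset.mem_erase.2 ⟨a.2, Finset.mem_univ _⟩
    · rintro _ ⟨a, ha, rfl⟩ _ ⟨b, hb, rfl⟩
      exact hS.2 a ha b hb
  · intro S hS
    rw [Finset.mem_filter] at hS
    simp only [Finset.mem_filter, Finset.powerset_univ, Finset.mem_univ, true_and]
    simp only [IndepFinset, Finset.mem_subtype]
    exact fun a ha b hb => hS.2 a ha b hb
  · intro S _
    ext a
    simp only [Finset.mem_subtype, Finset.mem_map, Function.Embedding.subtype_apply]
    exact ⟨fun ⟨b, hb, h⟩ => Subtype.ext h ▸ hb, fun h => ⟨a, h, rfl⟩⟩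
  · intro S hS
    refine Finset.subtype_map_of_mem fun w hw => ?_
    exact Finset.ne_of_mem_erase (Finset.mem_powerset.1 (Finset.mem_filter.1 hS).1 hw)
  · intro S _
    simp

/-- Independent sets of `G ∖ uv` are those of `G` together with those containing both ends. -/
theorem indepEval_deleteEdges {u v : V} (huv : G.Adj u v) (x : ℝ) :
    indepEval (G.deleteEdges {s(u, v)}) Finset.univ x = indepEval G Finset.univ x +
      x ^ 2 * indepEval G
        {w | w ≠ u ∧ w ≠ v ∧ ¬ G.Adj u w ∧ ¬ G.Adj v w} x := by
  have hne : u ≠ v := huv.ne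
  unfold indepEval
  rw [← Finset.sum_filter_add_sum_filter_not _ (fun S : Finset V => ¬ (u ∈ S ∧ v ∈ S)),
    Finset.filter_filter, Finset.filter_filter, Finset.mul_sum]
  congr 1
  · refine Finset.sum_congr ?_ fun _ _ => rfl
    ext S
    simp only [Finset.mem_filter, IndepFinset, SimpleGraph.deleteEdges_adj, Set.mem_singleton_iff,
      Sym2.eq_iff]
    grind
  · refine Finset.sum_bij' (fun S _ => (S.erase u).erase v) (fun S _ => insert u (insert v S))
      ?_ ?_ ?_ ?_ ?_
    · intro S hS
      simp [IndepFinset, Finset.subset_iff, SimpleGraph.deleteEdges_adj] at hS ⊢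
      grind
    · intro S hS
      have := G.adj_comm
      have : ∀ a, ¬ G.Adj a a := fun a => G.irrefl
      simp [IndepFinset, Finset.subset_iff, SimpleGraph.deleteEdges_adj] at hS ⊢
      grind
    · intro S hS
      simp at hS
      grind
    · intro S hS
      simp [IndepFinset, Finset.subset_iff] at hS
      grind
    · intro S hS
      simp at hS
      obtain ⟨-, hu, hv⟩ := hS
      have hv' : v ∈ S.erase u := Finset.mem_erase.2 ⟨hne.symm, hv⟩
      rw [← Finset.card_erase_add_one hu, ← Finset.card_erase_add_one hv']
      ring

theorem exists_isRoot_ge {z : ℝ} (hz : (uIndepPoly G).eval z ≤ 0) :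
    ∃ y, z ≤ y ∧ (uIndepPoly G).IsRoot y := by
  rw [eval_uIndepPoly] at hz
  obtain ⟨y, hy, hy'⟩ := intermediate_value_Icc (neg_of_indepEval_nonpos G hz).le
    (continuous_indepEval G Finset.univ).continuousOn
    ⟨hz, zero_le_one.trans (one_le_indepEval G _ le_rfl)⟩
  exact ⟨y, hy.1, (eval_uIndepPoly G y).trans hy'⟩

theorem le_lam1 {z : ℝ} (hz : (uIndepPoly G).eval z ≤ 0) : z ≤ lam1 G := by
  obtain ⟨y, hzy, hy⟩ := exists_isRoot_ge G hz
  refine hzy.trans (le_csSup ⟨0, fun t ht => ?_⟩ hy)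
  exact (neg_of_indepEval_nonpos G ((eval_uIndepPoly G t).symm.trans ht).le).le

theorem exists_isRoot_uIndepPoly [Nonempty V] : ∃ x : ℝ, (uIndepPoly G).IsRoot x := by
  obtain ⟨v⟩ := ‹Nonempty V›
  have h : indepEval G {v} (-1) ≤ 0 := by
    rw [indepEval_eq_erase_add G (Finset.mem_singleton_self v)]
    simp [indepEval_empty]
  obtain ⟨y, -, hy⟩ := exists_indepEval_nonpos_of_subset G (Finset.subset_univ _) h
  obtain ⟨t, -, ht⟩ := exists_isRoot_ge G ((eval_uIndepPoly G y).trans_le hy)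
  exact ⟨t, ht⟩

theorem le_lam1_of_indepEval_nonpos {W : Finset V} {z : ℝ} (hz : indepEval G W z ≤ 0) :
    z ≤ lam1 G := by
  obtain ⟨y, hzy, hy⟩ := exists_indepEval_nonpos_of_subset G (Finset.subset_univ W) hz
  exact hzy.trans (le_lam1 G ((eval_uIndepPoly G y).trans_le hy))

end indepEval

/-- For a finite simple graph `G` with at least one vertex, the univariate independence
polynomial has a real root; moreover deleting a vertex (as long as a vertex remains) or
deleting an edge can only decrease the largest real root `λ₁`. -/
theorem lam1_monotone_delete {V : Type*} [Fintype V] [Nonempty V] (G : SimpleGraph V) :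
    (∃ x : ℝ, (uIndepPoly G).IsRoot x) ∧
    (∀ v : V, (∃ u : V, u ≠ v) → lam1 (G.induce {u : V | u ≠ v}) ≤ lam1 G) ∧
    (∀ e ∈ G.edgeSet, lam1 (G.deleteEdges {e}) ≤ lam1 G) := by
  refine ⟨exists_isRoot_uIndepPoly G, ?_, ?_⟩
  · rintro v ⟨u, hu⟩
    have : Nonempty {u : V | u ≠ v} := ⟨⟨u, hu⟩⟩
    refine csSup_le (exists_isRoot_uIndepPoly _) fun z hz => ?_
    exact le_lam1_of_indepEval_nonpos G ((eval_uIndepPoly_induce_ne G v z).symm.trans hz).le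
  · intro e he
    induction e using Sym2.ind with
    | _ u v =>
    refine csSup_le (exists_isRoot_uIndepPoly _) fun z hz => ?_
    have hz' := (eval_uIndepPoly _ z).symm.trans hz
    rw [indepEval_deleteEdges G he] at hz'
    rcases le_total (indepEval G {w | w ≠ u ∧ w ≠ v ∧ ¬ G.Adj u w ∧ ¬ G.Adj v w} z) 0 with h | h
    · exact le_lam1_of_indepEval_nonpos G h
    · refine le_lam1_of_indepEval_nonpos G (W := Finset.univ) ?_
      linarith [mul_nonneg (sq_nonneg z) h]
end
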